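/- arXiv:1503.04636 — 5 statements merged into one kernel-verified Lean document; each statement's English description precedes it below -/
import Mathlib

section
/- Let n ≥ 1 be an integer and let p ∈ ℚ[X] be the (unique) polynomial of degree at most n with p(0) = 0 and p(k) = A(n,k) for every integer k with 1 ≤ k ≤ n. Then p(−1) = −((2^{2n} − 2)/2^{2n}) · B_{2n} and p(−2) = −(2n−1) · B_{2n}. -/
/-- `A(n,k) := (2·(2n)!/(2n+k)!) · ∑_{j=0}^{⌊k/2⌋} (−1)^j · C(k,j) · (k/2 − j)^{k+2n}` in `ℚ`. -/
def A (n k : ℕ) : ℚ :=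
  (2 * (Nat.factorial (2 * n) : ℚ) / (Nat.factorial (2 * n + k) : ℚ)) *
    ∑ j ∈ Finset.range (k / 2 + 1),
      (-1 : ℚ) ^ j * (Nat.choose k j : ℚ) * ((k : ℚ) / 2 - (j : ℚ)) ^ (k + 2 * n)

open PowerSeries in
theorem aux_exp_pow (a : ℚ) (m : ℕ) :
    (rescale a (exp ℚ)) ^ m = rescale ((m : ℚ) * a) (exp ℚ) := by
  induction m with
  | zero => simp
  | succ m ih =>
    rw [pow_succ, ih, exp_mul_exp_eq_exp_add]
    congr 2
    push_cast
    ring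

theorem aux_half (g : ℕ → ℚ) (k : ℕ) (hs : ∀ j, j ≤ k → g (k - j) = g j)
    (hz : ∀ j, 2 * j = k → g j = 0) :
    ∑ j ∈ Finset.range (k + 1), g j = 2 * ∑ j ∈ Finset.range (k / 2 + 1), g j := by
  obtain ⟨m, hm | hm⟩ := Nat.even_or_odd' k
  · have e1 : k + 1 = (m + 1) + m := by omega
    have e2 : k / 2 = m := by omega
    rw [e1, e2, Finset.sum_range_add, Finset.sum_range_succ, hz m hm.symm,
      ← Finset.sum_range_reflect (fun x => g (m + 1 + x))]
    have : ∑ j ∈ Finset.range m, g (m + 1 + (m - 1 - j)) = ∑ j ∈ Finset.range m, g j := by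
      refine Finset.sum_congr rfl fun j hj => ?_
      have := Finset.mem_range.1 hj
      rw [← hs j (by omega)]
      congr 1
      omega
    rw [this]
    ring
  · have e1 : k + 1 = (m + 1) + (m + 1) := by omega
    have e2 : k / 2 = m := by omega
    rw [e1, e2, Finset.sum_range_add,
      ← Finset.sum_range_reflect (fun x => g (m + 1 + x))]
    have : ∑ j ∈ Finset.range (m + 1), g (m + 1 + (m + 1 - 1 - j))
        = ∑ j ∈ Finset.range (m + 1), g j := by
      refine Finset.sum_congr rfl fun j hj => ?_
      have := Finset.mem_range.1 hj
      rw [← hs j (by omega)]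
      congr 1
      omega
    rw [this]
    ring

open PowerSeries in
theorem aux_A (n k : ℕ) (hn : 1 ≤ n) (S : PowerSeries ℚ)
    (hS : X * S = rescale (1 / 2 : ℚ) (exp ℚ) - rescale (-(1 / 2) : ℚ) (exp ℚ)) :
    A n k = (Nat.factorial (2 * n) : ℚ) * coeff (2 * n) (S ^ k) := by
  rw [← coeff_X_pow_mul (S ^ k) k (2 * n), ← mul_pow, hS, sub_eq_neg_add, add_pow, map_sum]
  have key : ∀ j ∈ Finset.range (k + 1),
      coeff (2 * n + k) ((-(rescale (-(1 / 2) : ℚ)) (exp ℚ)) ^ j *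
        (rescale (1 / 2 : ℚ) (exp ℚ)) ^ (k - j) * (k.choose j : PowerSeries ℚ))
      = (1 / (Nat.factorial (2 * n + k) : ℚ)) *
        ((-1 : ℚ) ^ j * (Nat.choose k j : ℚ) * ((k : ℚ) / 2 - (j : ℚ)) ^ (k + 2 * n)) := by
    intro j hj
    have hj' : j ≤ k := by have := Finset.mem_range.1 hj; omega
    rw [neg_pow, aux_exp_pow, aux_exp_pow, mul_assoc ((-1) ^ j), exp_mul_exp_eq_exp_add]
    have e : (j : ℚ) * -(1 / 2) + ((k - j : ℕ) : ℚ) * (1 / 2) = (k : ℚ) / 2 - j := by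
      push_cast [hj']
      ring
    rw [e]
    have e2 : (-1 : PowerSeries ℚ) ^ j * rescale ((k : ℚ) / 2 - j) (exp ℚ) *
        (k.choose j : PowerSeries ℚ)
        = C ((-1 : ℚ) ^ j * (k.choose j : ℚ)) * rescale ((k : ℚ) / 2 - j) (exp ℚ) := by
      simp only [map_mul, map_pow, map_neg, map_one, map_natCast]
      ring
    rw [e2, coeff_C_mul, coeff_rescale, coeff_exp, add_comm k (2 * n)]
    simp
    ring
  rw [Finset.sum_congr rfl key, ← Finset.mul_sum, aux_half, A]
  · ring
  · intro j hj
    rw [Nat.choose_symm hj]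
    push_cast [hj]
    have e : (k : ℚ) / 2 - (k - j) = (-1) * ((k : ℚ) / 2 - j) := by ring
    rw [e, mul_pow]
    have : (-1 : ℚ) ^ (k - j) * (-1) ^ (k + 2 * n) = (-1) ^ j := by
      rw [← pow_add, show k - j + (k + 2 * n) = j + 2 * (k - j + n) by omega, pow_add, pow_mul]
      simp
    rw [← this]
    ring
  · intro j hj
    have : (k : ℚ) / 2 - j = 0 := by
      rw [← hj]; push_cast; ring
    rw [this, zero_pow (by omega), mul_zero]

open PowerSeries in
/-- vanishing alternating sum -/
theorem aux_vanish (n : ℕ) (S V : PowerSeries ℚ) (h : X ^ 2 ∣ S - 1) :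
    ∑ i ∈ Finset.range (n + 1 + 1),
      ((-1 : ℚ) ^ (n + 1 - i) * ((n + 1).choose i : ℚ)) * coeff (2 * n) (V * S ^ i) = 0 := by
  have h1 : (X : PowerSeries ℚ) ^ (2 * (n + 1)) ∣ V * (S - 1) ^ (n + 1) := by
    rw [pow_mul]
    exact (pow_dvd_pow_of_dvd h _).mul_left _
  have h2 := X_pow_dvd_iff.1 h1 (2 * n) (by omega)
  rw [sub_eq_add_neg, add_pow, Finset.mul_sum, map_sum] at h2
  rw [← h2]
  refine Finset.sum_congr rfl fun i _ => ?_
  rw [← coeff_C_mul]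
  congr 1
  simp only [map_mul, map_pow, map_neg, map_one, map_natCast]
  ring

theorem aux_poly (n : ℕ) (p : Polynomial ℚ) (hdeg : p.natDegree ≤ n) (y : ℚ) :
    ∑ i ∈ Finset.range (n + 1 + 1),
      ((-1 : ℚ) ^ (n + 1 - i) * ((n + 1).choose i : ℚ)) * p.eval (y + i) = 0 := by
  have h := congrFun (Polynomial.fwdDiff_iter_eq_zero_of_degree_lt
    (P := p) (n := n + 1) (by omega)) y
  rw [fwdDiff_iter_eq_sum_shift] at h
  simpa using h

open PowerSeries in
theorem aux_step (n : ℕ) (p : Polynomial ℚ) (hdeg : p.natDegree ≤ n) (y c : ℚ)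
    (S V : PowerSeries ℚ) (h : X ^ 2 ∣ S - 1)
    (hv : ∀ i : ℕ, i ≤ n → p.eval (y + (i + 1 : ℕ)) = c * coeff (2 * n) (V * S ^ (i + 1))) :
    p.eval y = c * coeff (2 * n) V := by
  have h1 := aux_poly n p hdeg y
  have h2 := aux_vanish n S V h
  rw [Finset.sum_range_succ'] at h1 h2
  rw [Finset.sum_congr rfl (fun i hi => by
    rw [hv i (by have := Finset.mem_range.1 hi; omega), mul_left_comm]), ← Finset.mul_sum] at h1
  have h3 : (-1 : ℚ) ^ (n + 1) ≠ 0 := pow_ne_zero _ (by norm_num)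
  simp only [Nat.sub_zero, Nat.choose_zero_right, Nat.cast_one, mul_one, pow_zero,
    Nat.cast_zero, add_zero] at h1 h2
  apply mul_left_cancel₀ h3
  linear_combination h1 - c * h2

open PowerSeries in
theorem eval_neg_one_neg_two (n : ℕ) (hn : 1 ≤ n) (p : Polynomial ℚ)
    (hdeg : p.natDegree ≤ n) (h0 : p.eval 0 = 0)
    (hA : ∀ k : ℕ, 1 ≤ k → k ≤ n → p.eval (k : ℚ) = A n k) :
    p.eval (-1) = -((2 ^ (2 * n) - 2) / 2 ^ (2 * n)) * bernoulli (2 * n) ∧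
    p.eval (-2) = -(2 * (n : ℚ) - 1) * bernoulli (2 * n) := by
  set E : PowerSeries ℚ := rescale (1 / 2 : ℚ) (exp ℚ) with hE
  set E' : PowerSeries ℚ := rescale (-(1 / 2) : ℚ) (exp ℚ) with hE'
  set f : PowerSeries ℚ := bernoulliPowerSeries ℚ with hf
  have hX : (X : PowerSeries ℚ) ≠ 0 := X_ne_zero
  have hfe : f * (exp ℚ - 1) = X := bernoulliPowerSeries_mul_exp_sub_one ℚ
  have hEE : E * E = exp ℚ := by
    rw [hE, exp_mul_exp_eq_exp_add]
    norm_num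
  have hEE' : E * E' = 1 := by
    rw [hE, hE', exp_mul_exp_eq_exp_add]
    norm_num
  obtain ⟨S, hS⟩ : (X : PowerSeries ℚ) ∣ E - E' := by
    rw [X_dvd_iff]
    rw [← coeff_zero_eq_constantCoeff_apply, map_sub, hE, hE', coeff_rescale, coeff_rescale]
    simp
  have hSU : S * (f * E) = 1 := by
    apply mul_left_cancel₀ hX
    calc X * (S * (f * E)) = (X * S) * (f * E) := by ring
      _ = f * (E * E - E * E') := by rw [← hS]; ring
      _ = X * 1 := by rw [hEE, hEE', hfe, mul_one]
  have hS1 : X ^ 2 ∣ S - 1 := by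
    rw [X_pow_dvd_iff]
    intro m hm
    rw [map_sub, ← coeff_succ_X_mul m S, ← hS]
    interval_cases m
    · simp [hE, hE', coeff_rescale, coeff_exp]; norm_num
    · simp [hE, hE', coeff_rescale, coeff_exp, coeff_one]
  have hc : ∀ k : ℕ, k ≤ n → p.eval (k : ℚ) = (Nat.factorial (2 * n) : ℚ) * coeff (2 * n) (S ^ k) := by
    intro k hk
    rcases Nat.eq_zero_or_pos k with rfl | hk0
    · simp [h0, coeff_one]
      omega
    · rw [hA k hk0 hk, aux_A n k hn S hS.symm]
  have hfac : (Nat.factorial (2 * n) : ℚ) ≠ 0 := by exact_mod_cast Nat.factorial_ne_zero _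
  have hcf : ∀ m, coeff m f = bernoulli m / (Nat.factorial m : ℚ) := by
    intro m
    simp [hf, bernoulliPowerSeries]
  -- first value
  have r1 : p.eval (-1) = (Nat.factorial (2 * n) : ℚ) * coeff (2 * n) (f * E) := by
    refine aux_step n p hdeg (-1) _ S (f * E) hS1 fun i hi => ?_
    rw [show (-1 : ℚ) + ((i + 1 : ℕ) : ℚ) = (i : ℚ) by push_cast; ring, hc i hi, pow_succ']
    rw [← mul_assoc, mul_comm (f * E) S, hSU, one_mul]
  have r2 : p.eval (-2) = (Nat.factorial (2 * n) : ℚ) * coeff (2 * n) ((f * E) ^ 2) := by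
    refine aux_step n p hdeg (-2) _ S ((f * E) ^ 2) hS1 fun i hi => ?_
    rcases i with _ | i
    · rw [show (-2 : ℚ) + ((0 + 1 : ℕ) : ℚ) = -1 by norm_num, r1]
      congr 2
      linear_combination (-(f * E)) * hSU
    · rw [show (-2 : ℚ) + ((i + 1 + 1 : ℕ) : ℚ) = (i : ℚ) by push_cast; ring, hc i (by omega)]
      congr 2
      calc S ^ i = (S * (f * E)) ^ 2 * S ^ i := by rw [hSU]; ring
        _ = _ := by ring
  constructor
  · rw [r1]
    set g : PowerSeries ℚ := rescale (1 / 2 : ℚ) f with hg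
    have hgE : g * (E - 1) = C (1 / 2 : ℚ) * X := by
      have := congrArg (rescale (1 / 2 : ℚ)) hfe
      rwa [map_mul, map_sub, map_one, rescale_X] at this
    have hE1 : E - 1 ≠ 0 := by
      intro h
      have := congrArg (coeff 1) h
      simp [hE, coeff_rescale, coeff_exp, coeff_one] at this
    have hC : (C (2 : ℚ) : PowerSeries ℚ) * C (1 / 2 : ℚ) = 1 := by
      rw [← map_mul]; norm_num
    have : f * E = C (2 : ℚ) * g - f := by
      apply mul_right_cancel₀ hE1
      linear_combination hfe + f * hEE - C (2 : ℚ) * hgE - X * hC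
    rw [this, map_sub, coeff_C_mul, hg, coeff_rescale, hcf, one_div, inv_pow]
    field_simp
    ring
  · rw [r2]
    have hd := congrArg (d⁄dX ℚ) hfe
    rw [Derivation.leibniz, map_sub, derivative_exp] at hd
    simp only [smul_eq_mul, derivative_X, Derivation.map_one_eq_zero, sub_zero] at hd
    have : (f * E) ^ 2 = f - X * d⁄dX ℚ f := by
      linear_combination f * hd + f ^ 2 * hEE - d⁄dX ℚ f * hfe
    obtain ⟨m, hm⟩ : ∃ m, 2 * n = m + 1 := ⟨2 * n - 1, by omega⟩
    have hm' : (2 : ℚ) * n = m + 1 := by exact_mod_cast hm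
    rw [this, map_sub, hm', hm, coeff_succ_X_mul, coeff_derivative, hcf]
    rw [hm] at hfac
    field_simp
    ring
end

section
/- For every integer n ≥ 1, ζ(2n) = n · ζ(2)^{n} · ∑_{l=1}^{n} (−1)^{l+1} · P(l, n), where the rational numbers P(l,n) are viewed as real (or complex) numbers. -/
/-- Riordan's coefficients `a(n,l)`: `a(0,0) = 1`, `a(n,0) = 0` for `n ≥ 1`, and for `l ≥ 1`,
`a(n,l) = ∑_{i=l−1}^{n−1} a(i,l−1) · C(2n+l−1, 2n−2i)`. -/
def a : ℕ → ℕ → ℚ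
  | 0, 0 => 1
  | _ + 1, 0 => 0
  | n, l + 1 => ∑ i ∈ Finset.Ico l n, a i l * (Nat.choose (2 * n + l) (2 * n - 2 * i) : ℚ)

/-- The P-polynomial values `P(j,n) := 6^n · a(n, n+1−j) / ((2n)! · (n+1−j) · C(3n+1−j, 2n))`
(for `1 ≤ j ≤ n`). -/
def P (j n : ℕ) : ℚ :=
  6 ^ n * a n (n + 1 - j) /
    ((Nat.factorial (2 * n) : ℚ) * ((n + 1 - j : ℕ) : ℚ) *
      (Nat.choose (3 * n + 1 - j) (2 * n) : ℚ))

namespace ZetaP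

open PowerSeries

/-- `sinh x / x` in the variable `t = x ^ 2`. -/
noncomputable def sh : PowerSeries ℚ := PowerSeries.mk fun m => 1 / ((2 * m + 1).factorial : ℚ)

/-- `cosh x` in the variable `t = x ^ 2`. -/
noncomputable def ch : PowerSeries ℚ := PowerSeries.mk fun m => 1 / ((2 * m).factorial : ℚ)

/-- `x * coth x` in the variable `t = x ^ 2`. -/
noncomputable def bs : PowerSeries ℚ :=
  PowerSeries.mk fun m => 4 ^ m * bernoulli (2 * m) / ((2 * m).factorial : ℚ)

lemma coeff_evalNeg (n : ℕ) : coeff n (evalNegHom (exp ℚ)) = (-1) ^ n / (n.factorial : ℚ) := by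
  simp [evalNegHom, coeff_rescale, coeff_exp, div_eq_mul_inv]

lemma expand_ch : (2 : PowerSeries ℚ) * expand 2 two_ne_zero ch = exp ℚ + evalNegHom (exp ℚ) := by
  rw [← map_ofNat (C (R := ℚ)) 2]
  ext n
  rw [coeff_C_mul, map_add, coeff_evalNeg, coeff_exp]
  rcases Nat.even_or_odd' n with ⟨k, rfl | rfl⟩
  · rw [coeff_expand_mul, ch, coeff_mk]
    simp [pow_mul]; ring
  · rw [coeff_expand_of_not_dvd _ _ _ (by omega)]
    simp [pow_add, pow_mul]; ring

lemma expand_sh : (2 : PowerSeries ℚ) * (X * expand 2 two_ne_zero sh)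
    = exp ℚ - evalNegHom (exp ℚ) := by
  rw [← map_ofNat (C (R := ℚ)) 2]
  ext n
  rw [coeff_C_mul, map_sub, coeff_evalNeg, coeff_exp]
  rcases n with _ | n
  · simp
  rw [coeff_succ_X_mul]
  rcases Nat.even_or_odd' n with ⟨k, rfl | rfl⟩
  · rw [coeff_expand_mul, sh, coeff_mk]
    simp [pow_add, pow_mul]; ring
  · rw [coeff_expand_of_not_dvd _ _ _ (by omega)]
    simp [pow_add, pow_mul]

lemma expand_bs : expand 2 two_ne_zero bs = rescale 2 (bernoulliPowerSeries ℚ) + X := by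
  ext n
  rw [map_add, coeff_rescale, bernoulliPowerSeries, coeff_mk, coeff_X]
  rcases Nat.even_or_odd' n with ⟨k, rfl | rfl⟩
  · rw [coeff_expand_mul, bs, coeff_mk, if_neg (by omega), pow_mul]
    norm_num; ring
  · rw [coeff_expand_of_not_dvd _ _ _ (by omega)]
    rcases k with _ | k
    · norm_num
    · rw [bernoulli_eq_zero_of_odd ⟨k + 1, rfl⟩ (by omega), if_neg (by omega)]
      simp

lemma bs_mul_sh : bs * sh = ch := by
  have hinj : Function.Injective (expand (R := ℚ) 2 two_ne_zero) := by
    intro f g h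
    ext n
    rw [← coeff_expand_mul 2 two_ne_zero f n, h, coeff_expand_mul]
  apply hinj
  rw [map_mul, expand_bs]
  have h1 := expand_ch
  have h2 := expand_sh
  have h3 := exp_mul_exp_neg_eq_one (A := ℚ)
  have h4 : rescale 2 (bernoulliPowerSeries ℚ) * ((exp ℚ) ^ 2 - 1) = 2 * X := by
    have h := congrArg (rescale (2 : ℚ)) (bernoulliPowerSeries_mul_exp_sub_one ℚ)
    rw [map_mul, map_sub, map_one, rescale_X] at h
    have h5 := exp_pow_eq_rescale_exp (A := ℚ) 2
    rw [Nat.cast_ofNat] at h5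
    rw [h5, h, map_ofNat]
  generalize rescale 2 (bernoulliPowerSeries ℚ) = B at *
  generalize expand 2 two_ne_zero ch = c at *
  generalize expand 2 two_ne_zero sh = s at *
  generalize evalNegHom (exp ℚ) = F at *
  generalize exp ℚ = E at *
  have hX : (2 * X : PowerSeries ℚ) ≠ 0 := by
    intro h
    have := congrArg (coeff 1) h
    rw [← map_ofNat (C (R := ℚ)) 2, coeff_C_mul] at this
    simp at this
  apply mul_left_cancel₀ hX
  linear_combination (B + X) * h2 + F * h4 - X * h1 - (B * E) * h3

/-- `sinh x / x - 1`. -/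
noncomputable def g : PowerSeries ℚ := sh - 1

lemma X_dvd_g : X ∣ g := by
  rw [X_dvd_iff, ← coeff_zero_eq_constantCoeff_apply, g, map_sub, sh, coeff_mk]; simp

lemma X_pow_dvd_g (l : ℕ) : X ^ l ∣ g ^ l := pow_dvd_pow_of_dvd X_dvd_g l

lemma coeff_X_mul_deriv (F : PowerSeries ℚ) (n : ℕ) :
    coeff n (X * d⁄dX ℚ F) = n * coeff n F := by
  rcases n with _ | n
  · simp
  · rw [coeff_succ_X_mul, coeff_derivative]; push_cast; ring

lemma deriv_g : 2 * (X * d⁄dX ℚ g) = ch - sh := by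
  rw [← map_ofNat (C (R := ℚ)) 2]
  ext n
  rw [coeff_C_mul, coeff_X_mul_deriv, g, map_sub, map_sub, ch, sh, coeff_mk, coeff_mk, coeff_one,
    Nat.factorial_succ]
  have : ((2 * n).factorial : ℚ) ≠ 0 := by positivity
  have h2 : (2 * (n : ℚ) + 1) ≠ 0 := by positivity
  rcases n with _ | n
  · simp
  · rw [if_neg (by omega)]
    push_cast at *
    field_simp
    ring

lemma coeff_g_pow_succ (n l : ℕ) :
    (2 * n + l + 1 : ℚ) * coeff n (g ^ (l + 1)) = (l + 1) * coeff n (g ^ l * (ch - 1)) := by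
  have h : C (2 : ℚ) * (X * d⁄dX ℚ (g ^ (l + 1))) + C (l + 1 : ℚ) * g ^ (l + 1)
      = C (l + 1 : ℚ) * (g ^ l * (ch - 1)) := by
    rw [derivative_pow]
    have h1 := deriv_g
    have h2 : sh = g + 1 := by simp [g]
    rw [h2] at h1
    simp only [map_ofNat, map_add, map_natCast, map_one, Nat.add_sub_cancel]
    push_cast
    linear_combination ((l : PowerSeries ℚ) + 1) * g ^ l * h1
  have h' := congrArg (coeff n) h
  rw [map_add, coeff_C_mul, coeff_C_mul, coeff_C_mul, coeff_X_mul_deriv] at h'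
  linear_combination h'

lemma a_eq (l : ℕ) : ∀ n, a n l = ((2 * n + l).factorial : ℚ) / l.factorial * coeff n (g ^ l) := by
  induction l with
  | zero =>
    intro n
    rcases n with _ | n
    · simp [a]
    · simp [a, coeff_one]
  | succ l ih =>
    intro n
    have h := coeff_g_pow_succ n l
    have hs : a n (l + 1) = ((2 * n + l).factorial : ℚ) / l.factorial *
        coeff n (g ^ l * (ch - 1)) := by
      rw [a, coeff_mul, Finset.Nat.sum_antidiagonal_eq_sum_range_succ
        (fun i j => coeff i (g ^ l) * coeff j (ch - 1)), Finset.sum_range_succ]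
      have h0 : coeff (n - n) (ch - 1) = 0 := by simp [ch]
      rw [h0, mul_zero, add_zero, Finset.mul_sum]
      have hsub : Finset.Ico l n ⊆ Finset.range n := by
        intro i hi; simp at hi ⊢; omega
      rw [← Finset.sum_subset hsub]
      · apply Finset.sum_congr rfl
        intro i hi
        rw [Finset.mem_Ico] at hi
        rw [ih i, map_sub, coeff_one, if_neg (by omega), ch, coeff_mk,
          Nat.choose_eq_factorial_div_factorial (by omega),
          Nat.cast_div (Nat.factorial_mul_factorial_dvd_factorial (by omega)) (by positivity),
          show 2 * n + l - (2 * n - 2 * i) = 2 * i + l by omega,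
          show 2 * (n - i) = 2 * n - 2 * i by omega]
        have h1 : ((2 * i + l).factorial : ℚ) ≠ 0 := by positivity
        have h2 : ((2 * n - 2 * i).factorial : ℚ) ≠ 0 := by positivity
        have h3 : (l.factorial : ℚ) ≠ 0 := by positivity
        push_cast
        field_simp
        ring
      · intro i hi hi'
        simp at hi hi'
        rw [X_pow_dvd_iff.mp (X_pow_dvd_g l) i (by omega)]
        ring
    rw [hs, ← add_assoc, Nat.factorial_succ, Nat.factorial_succ]
    have h3 : (l.factorial : ℚ) ≠ 0 := by positivity
    have h4 : (l + 1 : ℚ) ≠ 0 := by positivity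
    push_cast
    field_simp
    linear_combination -h

lemma log_coeff (n : ℕ) (hn : 1 ≤ n) :
    2 * (n : ℚ) * ∑ k ∈ Finset.range n, (-1) ^ k / (k + 1 : ℚ) * coeff n (g ^ (k + 1))
      = 4 ^ n * bernoulli (2 * n) / ((2 * n).factorial : ℚ) := by
  set L : PowerSeries ℚ := ∑ k ∈ Finset.range n, ((-1) ^ k / (k + 1 : ℚ)) • g ^ (k + 1) with hL
  have hdL : d⁄dX ℚ L = (∑ k ∈ Finset.range n, (-g) ^ k) * d⁄dX ℚ g := by
    rw [hL, map_sum, Finset.sum_mul]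
    apply Finset.sum_congr rfl
    intro k _
    rw [Derivation.map_smul, derivative_pow, smul_eq_C_mul, Nat.add_sub_cancel,
      ← map_natCast (C (R := ℚ)), ← mul_assoc, ← mul_assoc, ← map_mul]
    have h4 : (k + 1 : ℚ) ≠ 0 := by positivity
    have : (-1) ^ k / (k + 1 : ℚ) * ((k + 1 : ℕ) : ℚ) = (-1) ^ k := by
      push_cast; field_simp
    rw [this, map_pow, map_neg, map_one, neg_pow g]
  have hgeo : (1 + g) * (∑ k ∈ Finset.range n, (-g) ^ k) = 1 - (-g) ^ n := by
    have := mul_neg_geom_sum (-g) n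
    rwa [sub_neg_eq_add] at this
  have hsh : sh = 1 + g := by simp [g]
  have hkey : sh * (2 * (X * d⁄dX ℚ L) - (bs - 1)) = X * (-g) ^ n * (-2 * d⁄dX ℚ g) := by
    have h1 := deriv_g
    have h2 := bs_mul_sh
    rw [hdL]
    rw [← hsh] at hgeo
    linear_combination (2 * X * d⁄dX ℚ g) * hgeo - h2 + h1
  have hdvd : X ^ (n + 1) ∣ sh * (2 * (X * d⁄dX ℚ L) - (bs - 1)) := by
    rw [hkey, pow_succ']
    apply Dvd.dvd.mul_right
    apply mul_dvd_mul_left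
    rw [neg_pow]
    exact (X_pow_dvd_g n).mul_left _
  have hu : IsUnit sh := by
    rw [isUnit_iff_constantCoeff, ← coeff_zero_eq_constantCoeff_apply, sh, coeff_mk]
    simp
  have hc := X_pow_dvd_iff.mp ((hu.dvd_mul_left).mp hdvd) n (by omega)
  rw [← map_ofNat (C (R := ℚ)) 2, map_sub, coeff_C_mul, coeff_X_mul_deriv, map_sub, coeff_one,
    if_neg (by omega), bs, coeff_mk, hL, map_sum] at hc
  simp only [coeff_smul, smul_eq_mul] at hc
  linear_combination hc

lemma P_eq (n k : ℕ) (hk : k < n) :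
    P (n - k) n = 6 ^ n * (coeff n (g ^ (k + 1)) / (k + 1)) := by
  rw [P, show n + 1 - (n - k) = k + 1 by omega, show 3 * n + 1 - (n - k) = 2 * n + (k + 1) by omega,
    a_eq, Nat.choose_symm_add, Nat.add_choose, Nat.cast_div (Nat.factorial_mul_factorial_dvd_factorial_add _ _)
      (by positivity)]
  have h1 : ((2 * n).factorial : ℚ) ≠ 0 := by positivity
  have h2 : ((k + 1).factorial : ℚ) ≠ 0 := by positivity
  have h3 : ((2 * n + (k + 1)).factorial : ℚ) ≠ 0 := by positivity
  have h4 : (k + 1 : ℚ) ≠ 0 := by positivity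
  push_cast
  field_simp

lemma P_sum (n : ℕ) (hn : 1 ≤ n) :
    2 * (n : ℚ) * ∑ l ∈ Finset.Icc 1 n, (-1) ^ (l + 1) * P l n
      = (-1) ^ (n + 1) * 6 ^ n * (4 ^ n * bernoulli (2 * n) / ((2 * n).factorial : ℚ)) := by
  have : ∑ l ∈ Finset.Icc 1 n, (-1) ^ (l + 1) * P l n =
      ∑ k ∈ Finset.range n, (-1) ^ (n - k + 1) * P (n - k) n := by
    symm
    apply Finset.sum_bij' (fun k _ => n - k) (fun l _ => n - l)
    · intro k hk; simp at hk ⊢; omega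
    · intro k hk; simp at hk ⊢; omega
    · intro k hk; simp at hk ⊢; omega
    · intro k hk; simp at hk ⊢; omega
    · intro k hk; rfl
  rw [this, ← log_coeff n hn, Finset.mul_sum, Finset.mul_sum, Finset.mul_sum]
  apply Finset.sum_congr rfl
  intro k hk
  rw [Finset.mem_range] at hk
  rw [P_eq n k hk]
  obtain ⟨m, rfl⟩ := Nat.exists_eq_add_of_lt hk
  rw [show k + m + 1 - k + 1 = m + 2 by omega]
  have : ((-1 : ℚ)) ^ (k + m + 1 + 1) * (-1) ^ k = (-1) ^ (m + 2) := by
    rw [← pow_add, show k + m + 1 + 1 + k = 2 * k + (m + 2) by ring, pow_add, pow_mul]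
    simp
  rw [← this]
  ring

end ZetaP

/-- For every integer `n ≥ 1`,
`ζ(2n) = n · ζ(2)^n · ∑_{l=1}^{n} (−1)^{l+1} · P(l, n)`. -/
theorem zeta_even_eq_P_sum (n : ℕ) (hn : 1 ≤ n) :
    riemannZeta ((2 * n : ℕ) : ℂ) =
      (n : ℂ) * (riemannZeta 2) ^ n *
        ∑ l ∈ Finset.Icc 1 n, (-1 : ℂ) ^ (l + 1) * ((P l n : ℚ) : ℂ) := by
  have h := congrArg (fun q : ℚ => (q : ℂ)) (ZetaP.P_sum n hn)
  push_cast at h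
  push_cast
  rw [riemannZeta_two_mul_nat (by omega), riemannZeta_two]
  have h2 : (2 : ℂ) * 2 ^ (2 * n - 1) = 4 ^ n := by
    rw [← pow_succ', show 2 * n - 1 + 1 = 2 * n by omega, pow_mul]; norm_num
  have h6 : (6 : ℂ) ^ n ≠ 0 := pow_ne_zero _ (by norm_num)
  have hf : ((2 * n).factorial : ℂ) ≠ 0 := by exact_mod_cast Nat.factorial_ne_zero _
  rw [div_pow, ← pow_mul]
  rw [← h2] at h
  apply mul_left_cancel₀ (mul_ne_zero two_ne_zero h6)
  field_simp at h ⊢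
  linear_combination -h
end

section
/- For every integer n ≥ 2, B_{2n}/(2n) = B_{2n−2}/(2n−2) + (−1)^{n+1} · ((2n)!/(2^{2n}·6^{n})) · C(2n, 4)^{−1} · ∑_{l=1}^{n} (−1)^{l+1} · C(n+4−l, 4) · P(l, n); in particular B_{2n} is determined by B_{2n−2} alone together with the numbers P(l,n). -/
open PowerSeries in
lemma aux_ode (b e : ℚ⟦X⟧) (hb : b * (e - 1) = X) (he : d⁄dX ℚ e = e) :
    ∃ w : ℚ⟦X⟧, w = b ^ 2 * e ∧ X * d⁄dX ℚ b = b - w ∧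
      6 * w ^ 2 = X * d⁄dX ℚ (X * d⁄dX ℚ w) - 5 * (X * d⁄dX ℚ w) + 6 * w - X ^ 2 * w := by
  have hbe : b * e = b + X := by linear_combination hb
  have h0 := congrArg (d⁄dX ℚ) hb
  simp only [Derivation.leibniz, map_sub, he, derivative_X, derivative_one, smul_eq_mul, sub_zero] at h0
  have hwdef : b ^ 2 + X * b = b ^ 2 * e := by linear_combination (-b) * hbe
  have h1 : X * d⁄dX ℚ b = b - (b ^ 2 + X * b) := by
    rw [hwdef]
    linear_combination (- d⁄dX ℚ b) * hb + b * h0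
  have hw : d⁄dX ℚ (b ^ 2 + X * b) = 2 * b * d⁄dX ℚ b + b + X * d⁄dX ℚ b := by
    simp only [pow_two, Derivation.leibniz, map_add, derivative_X, smul_eq_mul]
    ring
  have hD : X * d⁄dX ℚ (b ^ 2 + X * b) = (b ^ 2 + X * b) + (b ^ 2 + X * b) - (b + b + X) * (b ^ 2 + X * b) := by
    rw [hw]
    linear_combination (2 * b + X) * h1
  refine ⟨b ^ 2 + X * b, hwdef, h1, ?_⟩
  generalize hg : b ^ 2 + X * b = w at *
  have h3 := congrArg (d⁄dX ℚ) hD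
  have h4 : d⁄dX ℚ (w + w - (b + b + X) * w) =
      2 * d⁄dX ℚ w - ((2 * d⁄dX ℚ b + 1) * w + (2 * b + X) * d⁄dX ℚ w) := by
    simp only [Derivation.leibniz, map_add, map_sub, derivative_X, smul_eq_mul]
    ring
  rw [h3, h4]
  have h5 : X * d⁄dX ℚ w = 2 * w - (2 * b + X) * w := by rw [hD]; ring
  have h6 : X * (2 * d⁄dX ℚ w - ((2 * d⁄dX ℚ b + 1) * w + (2 * b + X) * d⁄dX ℚ w))
     = 2 * (X * d⁄dX ℚ w) - (2 * (X * d⁄dX ℚ b) + X) * w - (2 * b + X) * (X * d⁄dX ℚ w) := by ring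
  rw [h6, h5, h1, ← hg]
  ring

open PowerSeries in
lemma coeff_X_deriv (f : ℚ⟦X⟧) (m : ℕ) : coeff m (X * d⁄dX ℚ f) = m * coeff m f := by
  cases m with
  | zero => simp
  | succ m => rw [coeff_succ_X_mul, coeff_derivative]; push_cast; ring

open PowerSeries in
lemma coeff_w_sq (m : ℕ) (w : ℚ⟦X⟧) (hw1 : X * d⁄dX ℚ (bernoulliPowerSeries ℚ) = bernoulliPowerSeries ℚ - w)
    (hw2 : 6 * w ^ 2 = X * d⁄dX ℚ (X * d⁄dX ℚ w) - 5 * (X * d⁄dX ℚ w) + 6 * w - X ^ 2 * w) :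
    6 * coeff (m + 2) (w ^ 2) = -((m : ℚ) + 1) * m * (m - 1) * bernoulli (m + 2) / (m + 2).factorial
      + (m - 1) * bernoulli m / m.factorial := by
  have hc : ∀ k, coeff k w = (1 - k) * (bernoulli k / k.factorial) := by
    intro k
    have := congrArg (coeff k) hw1
    rw [coeff_X_deriv, map_sub] at this
    simp only [bernoulliPowerSeries, coeff_mk, Algebra.algebraMap_self, RingHom.id_apply] at this
    linear_combination this
  have := congrArg (coeff (m + 2)) hw2
  have c6 : (6 : ℚ⟦X⟧) = C 6 := (map_ofNat C 6).symm
  have c5 : (5 : ℚ⟦X⟧) = C 5 := (map_ofNat C 5).symm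
  rw [c6, c5] at this
  simp only [map_sub, map_add, coeff_C_mul, coeff_X_deriv, coeff_X_pow_mul, hc] at this
  rw [this]
  push_cast
  ring

open PowerSeries in
noncomputable def auxU : ℚ⟦X⟧ := mk fun m => if Even m ∧ m ≠ 0 then 1 / ((m + 1).factorial : ℚ) else 0

open PowerSeries in
noncomputable def auxc : ℚ⟦X⟧ := mk fun m => if Even m ∧ m ≠ 0 then 1 / (m.factorial : ℚ) else 0

open PowerSeries in
lemma auxc_eq : auxc = auxU + X * d⁄dX ℚ auxU := by
  ext m
  rw [map_add, coeff_X_deriv]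
  simp only [auxc, auxU, coeff_mk]
  split_ifs with h
  · rw [Nat.factorial_succ]
    have : (m.factorial : ℚ) ≠ 0 := by positivity
    push_cast
    field_simp
    ring
  · simp

lemma sum_range_even (f : ℕ → ℚ) (hf : ∀ i, f (2 * i + 1) = 0) (n : ℕ) :
    ∑ i ∈ Finset.range (2 * n + 1), f i = ∑ i ∈ Finset.range (n + 1), f (2 * i) := by
  induction n with
  | zero => simp
  | succ n ih =>
    rw [show 2 * (n + 1) + 1 = 2 * n + 1 + 1 + 1 by ring, Finset.sum_range_succ, Finset.sum_range_succ, ih,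
      Finset.sum_range_succ _ (n + 1), hf, show 2 * n + 1 + 1 = 2 * (n + 1) by ring]
    ring

lemma a_eq_zero (n l : ℕ) (h : n < l) : a n l = 0 := by
  cases l with
  | zero => omega
  | succ l =>
    rw [a, Finset.Ico_eq_empty (by omega)]
    simp

open PowerSeries in
lemma coeff_auxU_pow (l : ℕ) : ∀ n : ℕ, coeff (2 * n) (auxU ^ l) =
    a n l * l.factorial / (2 * n + l).factorial := by
  induction l with
  | zero =>
    intro n
    cases n with
    | zero => simp [a]
    | succ n => rw [a]; simp [coeff_one]
  | succ l ih =>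
    intro n
    have hder : (((l + 1 : ℕ) : ℚ⟦X⟧)) * auxU ^ (l + 1) + X * d⁄dX ℚ (auxU ^ (l + 1)) =
        ((l + 1 : ℕ) : ℚ⟦X⟧) * (auxU ^ l * auxc) := by
      rw [auxc_eq, derivative_pow]
      simp only [Nat.add_sub_cancel]
      ring
    have h := congrArg (coeff (2 * n)) hder
    have hC : ((l + 1 : ℕ) : ℚ⟦X⟧) = C ((l + 1 : ℕ) : ℚ) := by simp
    rw [hC, map_add, coeff_X_deriv, coeff_C_mul, coeff_C_mul, coeff_mul,
      Finset.Nat.sum_antidiagonal_eq_sum_range_succ (fun i j => coeff i (auxU ^ l) * coeff j auxc),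
      Nat.succ_eq_add_one] at h
    have hs : ∑ k ∈ Finset.range (2 * n + 1), coeff k (auxU ^ l) * coeff (2 * n - k) auxc =
        a n (l + 1) * l.factorial / (2 * n + l).factorial := by
      have e1 : ∑ k ∈ Finset.range (2 * n + 1), coeff k (auxU ^ l) * coeff (2 * n - k) auxc =
          ∑ k ∈ Finset.range (2 * n + 1), if Even k then coeff k (auxU ^ l) * coeff (2 * n - k) auxc else 0 := by
        refine Finset.sum_congr rfl fun k hk => ?_
        rw [Finset.mem_range] at hk
        split_ifs with hk2
        · rfl
        · have : ¬ Even (2 * n - k) := by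
            rw [Nat.even_sub (by omega)]
            simp [hk2]
          simp [auxc, this]
      rw [e1, sum_range_even _ (by intro i; simp)]
      have : a n (l + 1) = ∑ i ∈ Finset.Ico l n, a i l * (Nat.choose (2 * n + l) (2 * n - 2 * i) : ℚ) := by
        rw [a]
      rw [this, Finset.sum_mul, Finset.sum_div]
      symm
      refine Finset.sum_subset_zero_on_sdiff ?_ ?_ ?_
      · intro i hi
        simp at hi ⊢
        omega
      · intro i hi
        simp only [Finset.mem_sdiff, Finset.mem_range, Finset.mem_Ico, not_and, not_lt] at hi
        rw [ih]
        by_cases hil : i < l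
        · simp [a_eq_zero i l hil]
        · have : i = n := by omega
          subst this
          simp [auxc]
      · intro i hi
        simp only [Finset.mem_Ico] at hi
        rw [if_pos (by simp), ih]
        have hev : Even (2 * n - 2 * i) ∧ 2 * n - 2 * i ≠ 0 :=
          ⟨⟨n - i, by omega⟩, by omega⟩
        simp only [auxc, coeff_mk, if_pos hev]
        rw [Nat.cast_choose ℚ (show 2 * n - 2 * i ≤ 2 * n + l by omega),
          show 2 * n + l - (2 * n - 2 * i) = 2 * i + l by omega]
        have h1 : ((2 * n + l).factorial : ℚ) ≠ 0 := by positivity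
        have h2 : ((2 * i + l).factorial : ℚ) ≠ 0 := by positivity
        have h3 : ((2 * n - 2 * i).factorial : ℚ) ≠ 0 := by positivity
        field_simp
    rw [hs] at h
    have h1 : ((2 * n + l).factorial : ℚ) ≠ 0 := by positivity
    have h2 : (2 * (n : ℚ) + l + 1) ≠ 0 := by positivity
    rw [← add_assoc, Nat.factorial_succ, Nat.factorial_succ]
    push_cast at h ⊢
    rw [eq_div_iff (by positivity)]
    field_simp at h
    linear_combination h

open PowerSeries in
lemma X_sq_dvd_auxU : (X : ℚ⟦X⟧) ^ 2 ∣ auxU := by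
  rw [X_pow_dvd_iff]
  intro m hm
  interval_cases m <;> simp [auxU]

open PowerSeries in
lemma geom4 (U v : ℚ⟦X⟧) (hv : v * (1 + U) = 1) (N : ℕ) :
    v ^ 4 = ∑ l ∈ Finset.range N, C ((-1) ^ l * (((l : ℚ) + 1) * (l + 2) * (l + 3) / 6)) * U ^ l
      + C ((-1) ^ N) * U ^ N * (C ((N : ℚ) * (N + 1) * (N + 2) / 6) * v + C ((N : ℚ) * (N + 1) / 2) * v ^ 2
        + C (N : ℚ) * v ^ 3 + v ^ 4) := by
  induction N with
  | zero => simp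
  | succ N ih =>
    rw [Finset.sum_range_succ]
    refine ih.trans ?_
    set c3 : ℚ⟦X⟧ := C (N : ℚ) with hc3
    set c2 : ℚ⟦X⟧ := C ((N : ℚ) * (N + 1) / 2) with hc2
    set c1 : ℚ⟦X⟧ := C ((N : ℚ) * (N + 1) * (N + 2) / 6) with hc1
    have e3 : C ((N + 1 : ℕ) : ℚ) = c3 + 1 := by simp [hc3]
    have e2 : C (((N + 1 : ℕ) : ℚ) * ((N + 1 : ℕ) + 1) / 2) = c2 + c3 + 1 := by
      rw [hc2, hc3, ← map_one (C (R := ℚ)), ← map_add, ← map_add]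
      congr 1; push_cast; ring
    have e1 : C (((N + 1 : ℕ) : ℚ) * ((N + 1 : ℕ) + 1) * ((N + 1 : ℕ) + 2) / 6) = c1 + c2 + c3 + 1 := by
      rw [hc1, hc2, hc3, ← map_one (C (R := ℚ)), ← map_add, ← map_add, ← map_add]
      congr 1; push_cast; ring
    have e0 : C ((-1) ^ N * (((N : ℚ) + 1) * (N + 2) * (N + 3) / 6)) = C ((-1 : ℚ) ^ N) * (c1 + c2 + c3 + 1) := by
      rw [hc1, hc2, hc3, ← map_one (C (R := ℚ)), ← map_add, ← map_add, ← map_add, ← map_mul]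
      congr 1; push_cast; ring
    have es : C ((-1 : ℚ) ^ (N + 1)) = - C ((-1 : ℚ) ^ N) := by
      rw [← map_neg]; congr 1; ring
    rw [e3, e2, e1, e0, es]
    linear_combination (C ((-1 : ℚ) ^ N) * U ^ N) *
      (v ^ 3 + (c3 + 1) * v ^ 2 + (c2 + c3 + 1) * v + (c1 + c2 + c3 + 1)) * hv

open PowerSeries in
lemma X_mul_auxV : 2 * X * (1 + auxU) = exp ℚ - evalNegHom (exp ℚ) := by
  ext m
  have c2 : (2 : ℚ⟦X⟧) = C 2 := (map_ofNat C 2).symm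
  rw [c2, mul_assoc, coeff_C_mul, map_sub, evalNegHom, coeff_rescale]
  cases m with
  | zero => simp
  | succ m =>
    rw [coeff_succ_X_mul, map_add]
    simp only [auxU, coeff_mk, coeff_one, coeff_exp, Algebra.algebraMap_self, RingHom.id_apply]
    rcases Nat.even_or_odd m with h | h
    · have h' : (-1 : ℚ) ^ (m + 1) = -1 := by rw [pow_succ, h.neg_one_pow]; ring
      rw [h']
      by_cases hm : m = 0
      · subst hm; norm_num
      · simp only [hm, h, if_false, ne_eq, not_false_eq_true, and_self, if_true]
        ring
    · have h' : (-1 : ℚ) ^ (m + 1) = 1 := by rw [pow_succ, h.neg_one_pow]; ring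
      have h2 : ¬ Even m := by simpa using h
      have hm : m ≠ 0 := by rintro rfl; simp at h
      rw [h']
      simp [h2, hm]

open PowerSeries in
lemma key (n : ℕ) (w : ℚ⟦X⟧) (hw : w = bernoulliPowerSeries ℚ ^ 2 * exp ℚ) :
    4 ^ n * coeff (2 * n) (w ^ 2) = ∑ l ∈ Finset.range (n + 1),
      (-1) ^ l * (((l : ℚ) + 1) * (l + 2) * (l + 3) / 6) * coeff (2 * n) (auxU ^ l) := by
  have c2 : (2 : ℚ⟦X⟧) = C 2 := (map_ofNat C 2).symm
  set β := rescale (2 : ℚ) (bernoulliPowerSeries ℚ) with hβ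
  have hE : rescale (2 : ℚ) (exp ℚ) = exp ℚ ^ 2 := by
    rw [exp_pow_eq_rescale_exp]; norm_num
  have h1 : β * (exp ℚ ^ 2 - 1) = 2 * X := by
    have := congrArg (rescale (2 : ℚ)) (bernoulliPowerSeries_mul_exp_sub_one ℚ)
    rw [map_mul, map_sub, map_one, hE, rescale_X] at this
    rw [this, c2]
  have h2 : (β * exp ℚ) * (1 + auxU) = 1 := by
    have hX : (2 * X : ℚ⟦X⟧) ≠ 0 := by
      intro h
      have h' := congrArg (coeff 1) h
      rw [c2, coeff_C_mul, coeff_one_X] at h'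
      simp at h'
    apply mul_left_cancel₀ hX
    have h3 := exp_mul_exp_neg_eq_one (A := ℚ)
    linear_combination (β * exp ℚ) * X_mul_auxV + h1 - β * h3
  have h4 : rescale (2 : ℚ) (w ^ 2) = (β * exp ℚ) ^ 4 := by
    rw [hw, map_pow, map_mul, map_pow, hE, ← hβ]; ring
  have h5 := congrArg (coeff (2 * n)) h4
  rw [coeff_rescale, geom4 auxU _ h2 (n + 1), map_add, map_sum, pow_mul] at h5
  have h6 : ∀ Q : ℚ⟦X⟧, coeff (2 * n) (C ((-1 : ℚ) ^ (n + 1)) * auxU ^ (n + 1) * Q) = 0 := by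
    intro Q
    have : (X : ℚ⟦X⟧) ^ (2 * (n + 1)) ∣ C ((-1 : ℚ) ^ (n + 1)) * auxU ^ (n + 1) * Q := by
      rw [pow_mul]
      exact Dvd.dvd.mul_right (Dvd.dvd.mul_left (pow_dvd_pow_of_dvd X_sq_dvd_auxU _) _) _
    exact X_pow_dvd_iff.mp this _ (by omega)
  rw [h6, add_zero] at h5
  simp only [coeff_C_mul] at h5
  rw [← h5]; norm_num

lemma P_term (n k : ℕ) (hk : k < n) :
    (-1 : ℚ) ^ (n - k + 1) * (Nat.choose (n + 4 - (n - k)) 4 : ℚ) * P (n - k) n =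
      6 ^ n * (-1) ^ n / 4 * ((-1) ^ (k + 1) * ((((k + 1 : ℕ) : ℚ) + 1) * ((k + 1 : ℕ) + 2) * ((k + 1 : ℕ) + 3) / 6)
        * PowerSeries.coeff (2 * n) (auxU ^ (k + 1))) := by
  rw [coeff_auxU_pow, P, show n + 4 - (n - k) = k + 4 by omega, show n + 1 - (n - k) = k + 1 by omega,
    show 3 * n + 1 - (n - k) = 2 * n + (k + 1) by omega, Nat.cast_choose ℚ (Nat.le_add_right _ _),
    Nat.cast_choose ℚ (show 4 ≤ k + 4 by omega), Nat.add_sub_cancel_left, Nat.add_sub_cancel]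
  have hs : (-1 : ℚ) ^ (n - k + 1) = (-1) ^ n * (-1) ^ (k + 1) := by
    obtain ⟨d, rfl⟩ : ∃ d, n = k + d := ⟨n - k, by omega⟩
    rw [Nat.add_sub_cancel_left, ← pow_add, show k + d + (k + 1) = 2 * k + (d + 1) by ring,
      pow_add _ (2 * k), pow_mul]
    simp
  rw [hs]
  have h1 : ((2 * n + (k + 1)).factorial : ℚ) ≠ 0 := by positivity
  have h2 : ((2 * n).factorial : ℚ) ≠ 0 := by positivity
  have h3 : (k.factorial : ℚ) ≠ 0 := by positivity
  have h4 : ((k : ℚ) + 1) ≠ 0 := by positivity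
  rw [show (k + 4).factorial = (k + 4) * ((k + 3) * ((k + 2) * ((k + 1) * k.factorial))) by
    simp [Nat.factorial_succ], show (k + 1).factorial = (k + 1) * k.factorial from Nat.factorial_succ k,
    show Nat.factorial 4 = 24 from rfl]
  push_cast
  field_simp
  ring

/-- For every integer `n ≥ 2`,
`B_{2n}/(2n) = B_{2n−2}/(2n−2) + (−1)^{n+1}·((2n)!/(2^{2n}·6^n))·C(2n,4)⁻¹·
∑_{l=1}^{n} (−1)^{l+1}·C(n+4−l,4)·P(l,n)`: `B_{2n}` is determined by `B_{2n−2}` alone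
together with the numbers `P(l,n)`. -/
theorem bernoulli_step_recurrence (n : ℕ) (hn : 2 ≤ n) :
    bernoulli (2 * n) / (2 * n) =
      bernoulli (2 * n - 2) / (2 * (n : ℚ) - 2) +
        (-1 : ℚ) ^ (n + 1) * ((Nat.factorial (2 * n) : ℚ) / (2 ^ (2 * n) * 6 ^ n)) *
          ((Nat.choose (2 * n) 4 : ℚ))⁻¹ *
          ∑ l ∈ Finset.Icc 1 n,
            (-1 : ℚ) ^ (l + 1) * (Nat.choose (n + 4 - l) 4 : ℚ) * P l n := by
  obtain ⟨w, hw, hw1, hw2⟩ := aux_ode (bernoulliPowerSeries ℚ) (PowerSeries.exp ℚ)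
    (bernoulliPowerSeries_mul_exp_sub_one ℚ) (PowerSeries.derivative_exp ℚ)
  have hsum : ∑ l ∈ Finset.Icc 1 n, (-1 : ℚ) ^ (l + 1) * (Nat.choose (n + 4 - l) 4 : ℚ) * P l n =
      6 ^ n * (-1) ^ n / 4 * (4 ^ n * PowerSeries.coeff (2 * n) (w ^ 2)) := by
    rw [key n w hw, Finset.sum_range_succ']
    have h0 : PowerSeries.coeff (2 * n) (auxU ^ 0) = 0 := by
      rw [pow_zero, PowerSeries.coeff_one, if_neg (by omega)]
    rw [h0, mul_zero, add_zero, Finset.mul_sum]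
    refine Finset.sum_nbij' (fun l => n - l) (fun k => n - k) ?_ ?_ ?_ ?_ ?_
    · intro l hl; simp at hl ⊢; omega
    · intro l hl; simp at hl ⊢; omega
    · intro l hl; simp at hl ⊢; omega
    · intro l hl; simp at hl ⊢; omega
    · intro l hl
      simp only [Finset.mem_Icc] at hl
      have := P_term n (n - l) (by omega)
      rw [show n - (n - l) = l by omega] at this
      exact this
  obtain ⟨m, rfl⟩ : ∃ m, n = m + 2 := ⟨n - 2, by omega⟩
  have hk := coeff_w_sq (2 * m + 2) w hw1 hw2
  rw [hsum]
  rw [show 2 * (m + 2) = 2 * m + 2 + 2 by ring, show 2 * m + 2 + 2 - 2 = 2 * m + 2 by omega]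
  have hc : PowerSeries.coeff (2 * m + 2 + 2) (w ^ 2) = (-(((2 * m + 2 : ℕ) : ℚ) + 1) * (2 * m + 2 : ℕ)
      * ((2 * m + 2 : ℕ) - 1) * bernoulli (2 * m + 2 + 2) / (2 * m + 2 + 2).factorial
      + ((2 * m + 2 : ℕ) - 1) * bernoulli (2 * m + 2) / (2 * m + 2).factorial) / 6 := by
    rw [← hk]; ring
  rw [hc, Nat.cast_choose ℚ (show 4 ≤ 2 * m + 2 + 2 by omega), show 2 * m + 2 + 2 - 4 = 2 * m by omega]
  rw [show (2 * m + 2 + 2).factorial = (2 * m + 4) * ((2 * m + 3) * ((2 * m + 2) * ((2 * m + 1) * (2 * m).factorial))) by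
      simp [Nat.factorial_succ],
    show (2 * m + 2).factorial = (2 * m + 2) * ((2 * m + 1) * (2 * m).factorial) by
      simp [Nat.factorial_succ], show Nat.factorial 4 = 24 from rfl]
  have h2 : ((2 * m).factorial : ℚ) ≠ 0 := by positivity
  have hs : (-1 : ℚ) ^ (m + 2 + 1) * (-1) ^ (m + 2) = -1 := by
    rw [← pow_add, show m + 2 + 1 + (m + 2) = 2 * (m + 2) + 1 by ring, pow_succ, pow_mul]; simp
  have h4 : (2 : ℚ) ^ (2 * m + 2 + 2) = 4 ^ (m + 2) := by
    rw [show 2 * m + 2 + 2 = 2 * (m + 2) by ring, pow_mul]; norm_num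
  rw [h4]
  have hd : 2 * (((m + 2 : ℕ) : ℚ)) - 2 = 2 * m + 2 := by push_cast; ring
  rw [hd]
  have p1 : (m : ℚ) + 1 ≠ 0 := by positivity
  have p2 : (m : ℚ) + 2 ≠ 0 := by positivity
  have p3 : 2 * (m : ℚ) + 1 ≠ 0 := by positivity
  have p4 : 2 * (m : ℚ) + 2 ≠ 0 := by positivity
  have p5 : 2 * (m : ℚ) + 3 ≠ 0 := by positivity
  have p6 : 2 * (m : ℚ) + 4 ≠ 0 := by positivity
  generalize bernoulli (2 * m + 2 + 2) = B at *
  generalize bernoulli (2 * m + 2) = B' at *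
  push_cast
  generalize (-1 : ℚ) ^ (m + 2 + 1) = s at *
  generalize (-1 : ℚ) ^ (m + 2) = t at *
  have q4 : (4 : ℚ) ^ (m + 2) ≠ 0 := by positivity
  have q6 : (6 : ℚ) ^ (m + 2) ≠ 0 := by positivity
  generalize (4 : ℚ) ^ (m + 2) = x at *
  generalize (6 : ℚ) ^ (m + 2) = y at *
  generalize ((2 * m).factorial : ℚ) = f at *
  have e1 : 2 * (m : ℚ) + 2 + 1 = 2 * m + 3 := by ring
  have e2 : 2 * (m : ℚ) + 2 - 1 = 2 * m + 1 := by ring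
  have e3 : 2 * ((m : ℚ) + 2) = 2 * m + 4 := by ring
  rw [e1, e2, e3]
  generalize 2 * (m : ℚ) + 1 = c1 at *
  generalize 2 * (m : ℚ) + 2 = c2 at *
  generalize 2 * (m : ℚ) + 3 = c3 at *
  generalize 2 * (m : ℚ) + 4 = c4 at *
  field_simp
  linear_combination 24 * (B * c2 - c4 * B') * hs
end

section
/- ζ(3) = π²/8 − (π²/12)·ln(π/3) + (π²/3) · ∑_{n=1}^{∞} ζ(2n)/((2n)(2n+1)(2n+2)) · (1/6)^{2n}, the series on the right converging. -/
open Real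

namespace ZThree
open Filter Topology MeasureTheory Set

noncomputable def Z (n : ℕ) : ℝ := ∑' m : ℕ, 1 / ((m : ℝ) + 1) ^ (2 * (n + 1))

lemma log_series (r t : ℝ) (h0 : 0 ≤ r) (h1 : r < 1) :
    HasSum (fun k : ℕ => r ^ k * cos (k * t) / k) (-(1/2) * log (1 - 2 * r * cos t + r ^ 2)) := by
  have hz : ‖(r : ℂ) * Complex.exp (t * Complex.I)‖ < 1 := by
    rw [norm_mul, Complex.norm_exp_ofReal_mul_I, Complex.norm_real, Real.norm_of_nonneg h0]
    simpa using h1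
  have h := Complex.hasSum_re (Complex.hasSum_taylorSeries_neg_log hz)
  convert! h using 1
  · ext k
    rw [mul_pow, ← Complex.exp_nat_mul, ← mul_assoc, Complex.div_natCast_re]
    rw [show ((k : ℂ) * (t : ℂ)) = ((k * t : ℝ) : ℂ) by push_cast; rfl, ← Complex.ofReal_pow,
      Complex.re_ofReal_mul, Complex.exp_ofReal_mul_I_re]
  · rw [Complex.neg_re, Complex.log_re]
    have : 1 - 2 * r * cos t + r ^ 2 = ‖1 - (r : ℂ) * Complex.exp (t * Complex.I)‖ ^ 2 := by
      rw [← Complex.normSq_eq_norm_sq, Complex.normSq_apply]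
      simp only [Complex.sub_re, Complex.one_re, Complex.re_ofReal_mul, Complex.exp_ofReal_mul_I_re,
        Complex.sub_im, Complex.one_im, Complex.im_ofReal_mul, Complex.exp_ofReal_mul_I_im]
      nlinarith [sin_sq_add_cos_sq t]
    rw [this, log_pow]
    push_cast; ring

lemma int_cos (a : ℝ) (k : ℕ) (hk : k ≠ 0) :
    ∫ t in (0:ℝ)..a, (a - t) * cos (k * t) = (1 - cos (k * a)) / k ^ 2 := by
  have hk' : (k : ℝ) ≠ 0 := by exact_mod_cast hk
  have := intervalIntegral.integral_eq_sub_of_hasDerivAt (a := 0) (b := a)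
    (f := fun t => (a - t) * sin (k * t) / k - cos (k * t) / k ^ 2)
    (f' := fun t => (a - t) * cos (k * t)) (fun t _ => by
      have h1 : HasDerivAt (fun t : ℝ => (k : ℝ) * t) k t := by
        simpa using (hasDerivAt_id t).const_mul (k : ℝ)
      have h2 : HasDerivAt (fun t : ℝ => a - t) (-1) t := by
        simpa using (hasDerivAt_id t).const_sub a
      convert! ((h2.mul h1.sin).div_const (k:ℝ)).sub (h1.cos.div_const ((k:ℝ)^2)) using 1
      field_simp
      ring)
    (Continuous.intervalIntegrable (by fun_prop) _ _)
  rw [this]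
  simp
  ring

lemma int_pow (a : ℝ) (n : ℕ) :
    ∫ t in (0:ℝ)..a, (a - t) * t ^ (2 * (n + 1)) =
      a ^ (2 * (n + 1) + 2) / ((2 * (n + 1) + 1) * (2 * (n + 1) + 2)) := by
  have : ∀ t : ℝ, (a - t) * t ^ (2 * (n + 1)) = a * t ^ (2 * (n + 1)) - t ^ (2 * (n + 1) + 1) := by
    intro t; ring
  simp_rw [this]
  rw [intervalIntegral.integral_sub (Continuous.intervalIntegrable (by fun_prop) _ _)
    (Continuous.intervalIntegrable (by fun_prop) _ _), intervalIntegral.integral_const_mul,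
    integral_pow, integral_pow]
  push_cast
  have h1 : (2 * ((n:ℝ) + 1) + 1) ≠ 0 := by positivity
  have h2 : (2 * ((n:ℝ) + 1) + 2) ≠ 0 := by positivity
  have h3 : (2 * ((n:ℝ) + 1) + 1 + 1) ≠ 0 := by positivity
  simp
  field_simp
  ring

lemma int_log (a : ℝ) (ha : 0 < a) :
    ∫ t in (0:ℝ)..a, (a - t) * log t = a ^ 2 / 2 * log a - 3 * a ^ 2 / 4 := by
  have := intervalIntegral.integral_eq_sub_of_hasDerivAt_of_le (a := 0) (b := a)
    (f := fun t => (a - t / 2) * (t * log t) - a * t + t ^ 2 / 4)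
    (f' := fun t => (a - t) * log t) ha.le (by
      have := continuous_mul_log
      fun_prop) (fun t ht => by
      have h0 : t ≠ 0 := ht.1.ne'
      have h1 := hasDerivAt_mul_log h0
      have h2 : HasDerivAt (fun t : ℝ => a - t / 2) (-(1/2)) t := by
        simpa using ((hasDerivAt_id t).div_const 2).const_sub a
      have h3 : HasDerivAt (fun t : ℝ => a * t) a t := by
        simpa using (hasDerivAt_id t).const_mul a
      have h4 : HasDerivAt (fun t : ℝ => t ^ 2 / 4) (t / 2) t := by
        convert! (hasDerivAt_pow 2 t).div_const 4 using 1
        simp; ring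
      convert! ((h2.mul h1).sub h3).add h4 using 1
      ring)
    (intervalIntegral.intervalIntegrable_log'.continuousOn_mul (by fun_prop))
  rw [this]
  simp
  ring

lemma series_r (a r : ℝ) (ha : 0 ≤ a) (h0 : 0 ≤ r) (h1 : r < 1) :
    HasSum (fun k : ℕ => r ^ k * ((1 - cos (k * a)) / k ^ 3))
      (∫ t in (0:ℝ)..a, (a - t) * (-(1/2) * log (1 - 2 * r * cos t + r ^ 2))) := by
  have key := intervalIntegral.hasSum_integral_of_dominated_convergence (μ := volume)
    (a := 0) (b := a) (F := fun (k : ℕ) t => (a - t) * (r ^ k * cos (k * t) / k))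
    (f := fun t => (a - t) * (-(1/2) * log (1 - 2 * r * cos t + r ^ 2)))
    (fun k _ => a * r ^ k) (fun k => Continuous.aestronglyMeasurable (by fun_prop))
    (fun k => ae_of_all _ fun t ht => by
      rw [uIoc_of_le ha] at ht
      rw [norm_mul]
      apply mul_le_mul _ _ (norm_nonneg _) ha
      · rw [Real.norm_of_nonneg (by linarith [ht.2])]; linarith [ht.1]
      · rw [norm_div, norm_mul, Real.norm_of_nonneg (pow_nonneg h0 k)]
        rcases Nat.eq_zero_or_pos k with rfl | hk
        · simp
        · have : (1:ℝ) ≤ k := by exact_mod_cast hk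
          rw [Real.norm_natCast]
          rw [div_le_iff₀ (by linarith)]
          have := abs_cos_le_one (k * t)
          have hr := pow_nonneg h0 k
          rw [Real.norm_eq_abs]
          gcongr
          linarith)
    (ae_of_all _ fun t _ => (summable_geometric_of_lt_one h0 h1).mul_left a)
    intervalIntegrable_const
    (ae_of_all _ fun t _ => (log_series r t h0 h1).mul_left (a - t))
  convert! key using 1
  ext k
  rcases Nat.eq_zero_or_pos k with rfl | hk
  · simp
  · have hk' : (k : ℝ) ≠ 0 := by exact_mod_cast hk.ne'
    have : ∀ t, (a - t) * (r ^ k * cos (k * t) / k) = r ^ k / k * ((a - t) * cos (k * t)) := by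
      intro t; ring
    simp_rw [this]
    rw [intervalIntegral.integral_const_mul, int_cos a k hk.ne']
    field_simp

lemma series_one :
    HasSum (fun k : ℕ => (1 - cos (k * (π / 3))) / (k : ℝ) ^ 3)
      (∫ t in (0:ℝ)..(π / 3), (π / 3 - t) * (- log (2 * sin (t / 2)))) := by
  have hpi := pi_pos
  set a := π / 3 with ha
  have ha0 : 0 < a := by positivity
  have hs3 : Summable (fun k : ℕ => 2 / (k : ℝ) ^ 3) := by
    simpa [div_eq_mul_inv] using (Real.summable_one_div_nat_pow.mpr (by norm_num : 1 < 3)).mul_left 2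
  have hb : ∀ k : ℕ, ‖(1 - cos (k * a)) / (k : ℝ) ^ 3‖ ≤ 2 / (k : ℝ) ^ 3 := by
    intro k
    rw [Real.norm_of_nonneg (div_nonneg (by linarith [cos_le_one (k * a)]) (by positivity))]
    gcongr
    linarith [neg_one_le_cos (k * a)]
  have hS : Summable (fun k : ℕ => (1 - cos (k * a)) / (k : ℝ) ^ 3) := hs3.of_norm_bounded hb
  have hev : ∀ᶠ r : ℝ in 𝓝[<] 1, 0 ≤ r ∧ r < 1 := by
    filter_upwards [Ioo_mem_nhdsLT (zero_lt_one (α := ℝ))] with r hr using ⟨hr.1.le, hr.2⟩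
  have hid : Tendsto (fun r : ℝ => r) (𝓝[<] 1) (𝓝 1) := tendsto_nhdsWithin_of_tendsto_nhds tendsto_id
  have L1 : Tendsto (fun r : ℝ => ∑' k : ℕ, r ^ k * ((1 - cos (k * a)) / (k : ℝ) ^ 3)) (𝓝[<] 1)
      (𝓝 (∑' k : ℕ, (1 - cos (k * a)) / (k : ℝ) ^ 3)) := by
    apply tendsto_tsum_of_dominated_convergence hs3
    · intro k
      simpa using (hid.pow k).mul_const ((1 - cos (k * a)) / (k : ℝ) ^ 3)
    · filter_upwards [hev] with r hr k
      rw [norm_mul, norm_pow, Real.norm_of_nonneg hr.1]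
      exact (mul_le_of_le_one_left (norm_nonneg _) (pow_le_one₀ hr.1 hr.2.le)).trans (hb k)
  have L2 : Tendsto (fun r : ℝ => ∫ t in (0:ℝ)..a, (a - t) * (-(1/2) * log (1 - 2 * r * cos t + r ^ 2)))
      (𝓝[<] 1) (𝓝 (∫ t in (0:ℝ)..a, (a - t) * (- log (2 * sin (t / 2))))) := by
    apply intervalIntegral.tendsto_integral_filter_of_dominated_convergence
      (fun t => a * (- log (sin t)))
    · filter_upwards with r
      exact Measurable.aestronglyMeasurable (by fun_prop)
    · filter_upwards [hev] with r hr
      refine ae_of_all _ fun t ht => ?_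
      rw [uIoc_of_le ha0.le] at ht
      have hsin : 0 < sin t := sin_pos_of_pos_of_lt_pi ht.1 (by linarith [ht.2])
      have hcos : 1 / 2 ≤ cos t := by
        rw [← cos_pi_div_three]
        exact cos_le_cos_of_nonneg_of_le_pi ht.1.le (by linarith) ht.2
      have e1 : sin t ^ 2 ≤ 1 - 2 * r * cos t + r ^ 2 := by
        nlinarith [sin_sq_add_cos_sq t, sq_nonneg (r - cos t)]
      have e2 : 1 - 2 * r * cos t + r ^ 2 ≤ 1 := by nlinarith [hr.1, hr.2]
      have e3 := log_le_log (by positivity) e1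
      have e4 := log_nonpos (le_trans (by positivity) e1) e2
      rw [log_pow] at e3
      push_cast at e3
      rw [norm_mul, Real.norm_of_nonneg (by linarith [ht.2]), Real.norm_of_nonneg (by linarith)]
      apply mul_le_mul (by linarith [ht.1]) (by linarith) (by linarith) ha0.le
    · exact intervalIntegrable_log_sin.neg.const_mul a
    · refine ae_of_all _ fun t ht => ?_
      rw [uIoc_of_le ha0.le] at ht
      have hsin : 0 < sin (t / 2) := sin_pos_of_pos_of_lt_pi (by linarith [ht.1]) (by linarith [ht.2])
      have e : 1 - 2 * 1 * cos t + 1 ^ 2 = (2 * sin (t / 2)) ^ 2 := by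
        have := cos_two_mul (t / 2)
        rw [show 2 * (t / 2) = t by ring] at this
        nlinarith [sin_sq_add_cos_sq (t / 2)]
      have hne : (1 - 2 * 1 * cos t + 1 ^ 2 : ℝ) ≠ 0 := by rw [e]; positivity
      have : - log (2 * sin (t / 2)) = -(1/2) * log (1 - 2 * 1 * cos t + 1 ^ 2) := by
        rw [e, log_pow]; push_cast; ring
      rw [this]
      apply Tendsto.const_mul
      apply Tendsto.const_mul
      refine Tendsto.log ?_ hne
      exact (((hid.const_mul 2).mul_const _).const_sub 1).add (hid.pow 2)
  have := tendsto_nhds_unique (L1.congr' (by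
    filter_upwards [hev] with r hr
    exact (series_r a r ha0.le hr.1 hr.2).tsum_eq)) L2
  rw [← this]
  exact hS.hasSum

lemma sin_series (x : ℝ) (h0 : 0 < x) (h1 : x < 1) :
    HasSum (fun n : ℕ => Z n * x ^ (2 * (n + 1)) / (n + 1)) (-log (sin (π * x) / (π * x))) := by
  have hpi := pi_pos
  have hsin : 0 < sin (π * x) := sin_pos_of_pos_of_lt_pi (by positivity) (by nlinarith)
  have hlt : ∀ m : ℕ, x ^ 2 / ((m : ℝ) + 1) ^ 2 < 1 := by
    intro m
    rw [div_lt_one (by positivity)]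
    have : (0:ℝ) ≤ m := Nat.cast_nonneg m
    apply pow_lt_pow_left₀ (by linarith) h0.le (by norm_num)
  have hrow : ∀ m : ℕ, HasSum (fun n : ℕ => (x ^ 2 / ((m : ℝ) + 1) ^ 2) ^ (n + 1) / ((n : ℝ) + 1))
      (- log (1 - x ^ 2 / ((m : ℝ) + 1) ^ 2)) := fun m =>
    hasSum_pow_div_log_of_abs_lt_one (by rw [abs_of_nonneg (by positivity)]; exact hlt m)
  have hcol : HasSum (fun m : ℕ => - log (1 - x ^ 2 / ((m : ℝ) + 1) ^ 2))
      (-log (sin (π * x) / (π * x))) := by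
    rw [hasSum_iff_tendsto_nat_of_nonneg]
    · have h := Real.tendsto_euler_sin_prod x
      have h' := (h.div_const (π * x)).log (by positivity)
      refine h'.neg.congr fun n => ?_
      rw [mul_div_cancel_left₀ _ (by positivity), log_prod, Finset.sum_neg_distrib]
      intro m _
      exact (sub_pos.mpr (hlt m)).ne'
    · intro m
      have := log_nonpos (sub_pos.mpr (hlt m)).le (by
        have : 0 ≤ x ^ 2 / ((m : ℝ) + 1) ^ 2 := by positivity
        linarith)
      linarith
  let f : ℕ × ℕ → ℝ := fun p => (x ^ 2 / ((p.1 : ℝ) + 1) ^ 2) ^ (p.2 + 1) / ((p.2 : ℝ) + 1)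
  have hf : Summable f := by
    rw [summable_prod_of_nonneg (fun p => by dsimp [f]; positivity)]
    refine ⟨fun m => (hrow m).summable, ?_⟩
    have : (fun m => ∑' n, f (m, n)) = fun m : ℕ => - log (1 - x ^ 2 / ((m : ℝ) + 1) ^ 2) := by
      ext m; exact (hrow m).tsum_eq
    rw [this]; exact hcol.summable
  have hsum : HasSum f (-log (sin (π * x) / (π * x))) := by
    have := hf.hasSum.prod_fiberwise hrow
    rw [← this.unique hcol]
    exact hf.hasSum
  have hsw : HasSum (fun p : ℕ × ℕ => f p.swap) (-log (sin (π * x) / (π * x))) :=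
    (Equiv.prodComm ℕ ℕ).hasSum_iff.mpr hsum
  refine hsw.prod_fiberwise fun n => ?_
  have hz : Summable (fun m : ℕ => 1 / ((m : ℝ) + 1) ^ (2 * (n + 1))) := by
    have := (summable_nat_add_iff 1).mpr
      (Real.summable_one_div_nat_pow.mpr (by omega : 1 < 2 * (n + 1)))
    simpa using this
  convert! (hz.hasSum.mul_right (x ^ (2 * (n + 1)))).div_const ((n : ℝ) + 1) using 1
  ext m
  simp only [f, Prod.swap]
  rw [div_pow, ← pow_mul, ← pow_mul]
  ring


lemma Z_nonneg (n : ℕ) : 0 ≤ Z n := tsum_nonneg fun m => by positivity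

lemma int_sin_series :
    HasSum (fun n : ℕ => 2 * (π / 3) ^ 2 * (Z n / ((2 * (n + 1)) * (2 * (n + 1) + 1) *
        (2 * (n + 1) + 2)) * (1 / 6) ^ (2 * (n + 1))))
      (∫ t in (0:ℝ)..(π / 3), (π / 3 - t) * (-log (sin (t / 2) / (t / 2)))) := by
  have hpi := pi_pos
  set a := π / 3 with ha
  have ha0 : 0 < a := by positivity
  have hpa : π = 3 * a := by rw [ha]; ring
  have key := intervalIntegral.hasSum_integral_of_dominated_convergence (μ := volume)
    (a := 0) (b := a)
    (F := fun (n : ℕ) t => (a - t) * (Z n * (t / (2 * π)) ^ (2 * (n + 1)) / (n + 1)))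
    (f := fun t => (a - t) * (-log (sin (t / 2) / (t / 2))))
    (fun n _ => a * (Z n * (1 / 6) ^ (2 * (n + 1)) / (n + 1)))
    (fun k => Continuous.aestronglyMeasurable (by fun_prop))
    (fun n => ae_of_all _ fun t ht => by
      rw [uIoc_of_le ha0.le] at ht
      have hz := Z_nonneg n
      have h0 : 0 ≤ t / (2 * π) := div_nonneg ht.1.le (by positivity)
      have h6 : t / (2 * π) ≤ 1 / 6 := by
        rw [div_le_iff₀ (by positivity)]; linarith [ht.2]
      rw [Real.norm_of_nonneg (mul_nonneg (by linarith [ht.2]) (by positivity))]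
      gcongr
      linarith [ht.1])
    (ae_of_all _ fun t _ => (sin_series (1/6) (by norm_num) (by norm_num)).summable.mul_left a)
    intervalIntegrable_const
    (ae_of_all _ fun t ht => by
      rw [uIoc_of_le ha0.le] at ht
      have := sin_series (t / (2 * π)) (div_pos ht.1 (by positivity))
        (by rw [div_lt_one (by positivity)]; linarith [ht.2])
      rw [show π * (t / (2 * π)) = t / 2 by field_simp] at this
      exact this.mul_left _)
  convert! key using 1
  ext n
  have : ∀ t, (a - t) * (Z n * (t / (2 * π)) ^ (2 * (n + 1)) / (n + 1)) =
      Z n / (2 * π) ^ (2 * (n + 1)) / (n + 1) * ((a - t) * t ^ (2 * (n + 1))) := by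
    intro t; rw [div_pow]; ring
  simp_rw [this]
  rw [intervalIntegral.integral_const_mul, int_pow, hpa, show 2 * (3 * a) = 6 * a by ring, mul_pow,
    pow_add a, one_div, inv_pow]
  have h2 : (2 * ((n:ℝ) + 1) + 2) ≠ 0 := by positivity
  have h3 : (2 * ((n:ℝ) + 1) + 1) ≠ 0 := by positivity
  have h4 : ((n:ℝ) + 1) ≠ 0 := by positivity
  field_simp

lemma int_split :
    ∫ t in (0:ℝ)..(π / 3), (π / 3 - t) * (-log (sin (t / 2) / (t / 2))) =
      (∫ t in (0:ℝ)..(π / 3), (π / 3 - t) * (- log (2 * sin (t / 2)))) +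
      ∫ t in (0:ℝ)..(π / 3), (π / 3 - t) * log t := by
  have hpi := pi_pos
  rw [← intervalIntegral.integral_add]
  · apply intervalIntegral.integral_congr_ae
    refine ae_of_all _ fun t ht => ?_
    rw [uIoc_of_le (by positivity)] at ht
    have hsin : 0 < sin (t / 2) := sin_pos_of_pos_of_lt_pi (by linarith [ht.1]) (by linarith [ht.2])
    have ht0 := ht.1
    rw [show sin (t / 2) / (t / 2) = (2 * sin (t / 2)) / t by field_simp,
      log_div (by positivity) (by positivity)]
    ring
  · apply IntervalIntegrable.continuousOn_mul _ (by fun_prop)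
    apply IntervalIntegrable.neg
    apply MeromorphicOn.intervalIntegrable_log
    intro t _
    apply AnalyticAt.meromorphicAt
    fun_prop
  · exact intervalIntegral.intervalIntegrable_log'.continuousOn_mul (by fun_prop)

lemma dvd_sum (d : ℕ) (hd : d ≠ 0) (s : ℝ) (h : HasSum (fun k : ℕ => 1 / (k : ℝ) ^ 3) s) :
    HasSum (fun k : ℕ => (if d ∣ k then (1:ℝ) else 0) / (k : ℝ) ^ 3) (s / d ^ 3) := by
  have hinj : Function.Injective (fun k : ℕ => d * k) := fun x y hxy =>
    Nat.eq_of_mul_eq_mul_left (Nat.pos_of_ne_zero hd) hxy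
  rw [← hinj.hasSum_iff]
  · convert! h.div_const ((d:ℝ) ^ 3) using 1
    ext k
    simp [mul_pow]
    ring
  · intro k hk
    have : ¬ d ∣ k := fun ⟨c, hc⟩ => hk ⟨c, hc.symm⟩
    simp [this]

lemma cos_six (k : ℕ) : cos (k * (π / 3)) = 1 / 2 - (if 2 ∣ k then (1:ℝ) else 0)
    - 3 / 2 * (if 3 ∣ k then (1:ℝ) else 0) + 3 * (if 6 ∣ k then (1:ℝ) else 0) := by
  have h3 := cos_pi_div_three
  have c2 : cos (2 * (π / 3)) = -1/2 := by rw [cos_two_mul, h3]; norm_num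
  have hk : k = k % 6 + 6 * (k / 6) := (Nat.mod_add_div k 6).symm
  have hper : cos (k * (π / 3)) = cos ((k % 6 : ℕ) * (π / 3)) := by
    conv_lhs => rw [hk]
    push_cast
    rw [← cos_add_nat_mul_two_pi (((k % 6 : ℕ) : ℝ) * (π / 3)) (k / 6)]
    push_cast
    congr 1; ring
  have e2 : 2 ∣ k ↔ 2 ∣ k % 6 := by omega
  have e3 : 3 ∣ k ↔ 3 ∣ k % 6 := by omega
  have e6 : 6 ∣ k ↔ 6 ∣ k % 6 := by omega
  rw [hper]
  simp only [e2, e3, e6]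
  have : k % 6 < 6 := Nat.mod_lt _ (by norm_num)
  generalize k % 6 = j at this
  interval_cases j
  · norm_num
  · norm_num
  · norm_num [c2]
  · norm_num [show 3 * (π / 3) = π by ring]
  · rw [show ((4:ℕ):ℝ) * (π / 3) = π / 3 + π by push_cast; ring, cos_add_pi]; norm_num
  · rw [show ((5:ℕ):ℝ) * (π / 3) = 2 * π - π / 3 by push_cast; ring, cos_two_pi_sub]; norm_num

lemma real_result (s : ℝ) (h : HasSum (fun k : ℕ => 1 / (k : ℝ) ^ 3) s) :
    ∃ S : ℝ, HasSum (fun n : ℕ => Z n / ((2 * (n + 1)) * (2 * (n + 1) + 1) *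
        (2 * (n + 1) + 2)) * (1 / 6) ^ (2 * (n + 1))) S ∧
      s = π ^ 2 / 8 - π ^ 2 / 12 * log (π / 3) + π ^ 2 / 3 * S := by
  have hpi := pi_pos
  have hS := int_sin_series
  have hne : 2 * (π / 3) ^ 2 ≠ 0 := by positivity
  have hS' := hS.mul_left (2 * (π / 3) ^ 2)⁻¹
  simp only [inv_mul_cancel_left₀ hne] at hS'
  refine ⟨_, hS', ?_⟩
  rw [int_split, int_log _ (by positivity)]
  have h1 := series_one
  have h2 := (((h.div_const 2).add (dvd_sum 2 (by norm_num) s h)).add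
    ((dvd_sum 3 (by norm_num) s h).mul_left (3/2))).sub ((dvd_sum 6 (by norm_num) s h).mul_left 3)
  have hfun : (fun k : ℕ => (1 - cos (k * (π / 3))) / (k : ℝ) ^ 3) = fun b : ℕ =>
      1 / (b : ℝ) ^ 3 / 2 + (if 2 ∣ b then (1:ℝ) else 0) / (b : ℝ) ^ 3 +
        3 / 2 * ((if 3 ∣ b then (1:ℝ) else 0) / (b : ℝ) ^ 3) -
        3 * ((if 6 ∣ b then (1:ℝ) else 0) / (b : ℝ) ^ 3) := by
    ext k
    rw [cos_six]
    ring
  rw [hfun] at h1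
  rw [h1.unique h2]
  push_cast
  field_simp
  ring

lemma zeta_real (k : ℕ) (hk : 1 < k) :
    riemannZeta (k : ℂ) = ((∑' n : ℕ, 1 / (n : ℝ) ^ k : ℝ) : ℂ) := by
  rw [zeta_nat_eq_tsum_of_gt_one hk]
  push_cast
  rfl

lemma zeta_Z (n : ℕ) : riemannZeta ((2 * (n + 1) : ℕ) : ℂ) = (Z n : ℂ) := by
  rw [zeta_real _ (by omega), Z,
    (Real.summable_one_div_nat_pow.mpr (by omega : 1 < 2 * (n + 1))).tsum_eq_zero_add]
  simp

end ZThree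

/-- `ζ(3) = π²/8 − (π²/12)·ln(π/3) +
(π²/3)·∑_{n=1}^{∞} ζ(2n)/((2n)(2n+1)(2n+2)) · (1/6)^{2n}`, the series converging.
(The series index `n ≥ 1` is realized as `n+1` for `n : ℕ`.) -/
theorem zeta_three_series :
    ∃ S : ℂ,
      HasSum
        (fun n : ℕ =>
          riemannZeta ((2 * (n + 1) : ℕ) : ℂ) /
              (((2 * (n + 1) : ℕ) : ℂ) * ((2 * (n + 1) + 1 : ℕ) : ℂ) *
                ((2 * (n + 1) + 2 : ℕ) : ℂ)) *
            (1 / 6 : ℂ) ^ (2 * (n + 1))) S ∧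
      riemannZeta 3 =
        (Real.pi : ℂ) ^ 2 / 8 - (Real.pi : ℂ) ^ 2 / 12 * (Real.log (Real.pi / 3) : ℂ) +
          (Real.pi : ℂ) ^ 2 / 3 * S := by
  obtain ⟨S, hS, h⟩ := ZThree.real_result _
    (Real.summable_one_div_nat_pow.mpr (by norm_num : 1 < 3)).hasSum
  refine ⟨(S : ℂ), ?_, ?_⟩
  · have := Complex.hasSum_ofReal.mpr hS
    convert! this using 1
    ext n
    rw [ZThree.zeta_Z]
    push_cast
    rfl
  · have h3 := ZThree.zeta_real 3 (by norm_num)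
    rw [h] at h3
    push_cast at h3
    simpa using h3
end

section
/- ζ(5) = (3π²/29)·ζ(3) − 25π⁴/12528 + (π⁴/1044)·ln(π/3) − (4π⁴/87) · ∑_{n=1}^{∞} ζ(2n)/((2n)(2n+1)(2n+2)(2n+3)(2n+4)) · (1/6)^{2n}, the series on the right converging. -/
open Real

namespace ZF
open Filter Topology Set

noncomputable def z (s : ℕ) : ℝ := ∑' m : ℕ, 1 / (m : ℝ) ^ s

lemma z_summable {s : ℕ} (hs : 1 < s) : Summable (fun m : ℕ => 1 / (m : ℝ) ^ s) :=
  Real.summable_one_div_nat_pow.2 hs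

lemma zeta_eq {s : ℕ} (hs : 1 < s) : riemannZeta (s : ℂ) = (z s : ℂ) := by
  rw [zeta_nat_eq_tsum_of_gt_one hs, z, Complex.ofReal_tsum]
  push_cast
  rfl

lemma z_hasSum {s : ℕ} (hs : 1 < s) : HasSum (fun m : ℕ => 1 / ((m : ℝ) + 1) ^ s) (z s) := by
  have h := (z_summable hs).hasSum
  rw [← hasSum_nat_add_iff' 1] at h
  have h0 : s ≠ 0 := by omega
  simpa [z, h0] using h

lemma z_nonneg (s : ℕ) : 0 ≤ z s := tsum_nonneg fun m => by positivity

lemma z_le {s : ℕ} (hs : 2 ≤ s) : z s ≤ z 2 := by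
  refine hasSum_le (fun m => ?_) (z_hasSum (by omega)) (z_hasSum (by omega : 1 < 2))
  apply one_div_le_one_div_of_le (by positivity)
  exact pow_le_pow_right₀ (by linarith [(Nat.cast_nonneg m : (0:ℝ) ≤ m)]) hs

lemma eq_aux {f g f' : ℝ → ℝ} (hf : ContinuousOn f (Ico 0 2)) (hg : ContinuousOn g (Ico 0 2))
    (hf' : ∀ x ∈ Ioo (0:ℝ) 2, HasDerivAt f (f' x) x)
    (hg' : ∀ x ∈ Ioo (0:ℝ) 2, HasDerivAt g (f' x) x) (h0 : f 0 = g 0) :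
    ∀ x ∈ Ico (0:ℝ) 2, f x = g x := by
  intro x hx
  rcases hx.1.eq_or_lt with rfl | hpos
  · exact h0
  have hsub : Icc 0 x ⊆ Ico (0:ℝ) 2 := fun y hy => ⟨hy.1, hy.2.trans_lt hx.2⟩
  obtain ⟨c, hc, h⟩ := exists_hasDerivAt_eq_slope (fun y => f y - g y) (fun y => f' y - f' y) hpos
    ((hf.mono hsub).sub (hg.mono hsub))
    (fun y hy => (hf' y ⟨hy.1, hy.2.trans hx.2⟩).sub (hg' y ⟨hy.1, hy.2.trans hx.2⟩))
  rw [eq_div_iff (by linarith)] at h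
  linarith

lemma pow_deriv {d : ℕ → ℝ} {e : ℕ → ℕ} (h : Summable fun n => |d n| * 2 ^ (e n)) {t : ℝ}
    (ht : t ∈ Ioo (-2:ℝ) 2) :
    HasDerivAt (fun t => ∑' n, d n / (e n + 1) * t ^ (e n + 1)) (∑' n, d n * t ^ (e n)) t := by
  refine hasDerivAt_tsum_of_isPreconnected (g := fun n t => d n / (e n + 1) * t ^ (e n + 1))
    (g' := fun n t => d n * t ^ (e n)) (t := Ioo (-2:ℝ) 2) (y₀ := 0) h isOpen_Ioo isPreconnected_Ioo ?_ ?_ (by simp) ?_ ht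
  · intro n y _
    have := (hasDerivAt_pow (e n + 1) y).const_mul (d n / (e n + 1))
    convert! this using 1
    have : (e n : ℝ) + 1 ≠ 0 := by positivity
    push_cast
    field_simp
  · intro n y hy
    rw [norm_mul, norm_pow, Real.norm_eq_abs, Real.norm_eq_abs]
    gcongr
    exact (abs_lt.2 ⟨hy.1, hy.2⟩).le
  · simp

lemma summ_cos {s : ℕ} (hs : 1 < s) (t : ℝ) : Summable fun k : ℕ => cos (k * t) / (k:ℝ) ^ s := by
  refine Summable.of_norm_bounded (z_summable hs) fun k => ?_
  rw [norm_div, Real.norm_eq_abs, Real.norm_eq_abs, abs_of_nonneg (by positivity : (0:ℝ) ≤ (k:ℝ)^s)]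
  gcongr
  exact abs_cos_le_one _

lemma cos_deriv {s : ℕ} (hs : 1 < s) (t : ℝ) :
    HasDerivAt (fun t => ∑' k : ℕ, cos (k * t) / (k:ℝ) ^ (s+1)) (- ∑' k : ℕ, sin (k * t) / (k:ℝ) ^ s) t := by
  rw [← tsum_neg]
  refine hasDerivAt_tsum (g := fun (k : ℕ) t => cos (k * t) / (k:ℝ) ^ (s+1)) (g' := fun (k : ℕ) t => -(sin (k * t) / (k:ℝ) ^ s))
    (y₀ := 0) (z_summable hs) ?_ ?_ (summ_cos (by omega) _) t
  · intro k y
    have := (((hasDerivAt_id y).const_mul (k:ℝ)).cos).div_const ((k:ℝ)^(s+1))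
    convert! this using 1
    rcases eq_or_ne k 0 with rfl | hk
    · simp
    · have : (k:ℝ) ≠ 0 := by exact_mod_cast hk
      simp only [id]
      field_simp
      ring
  · intro k y
    rw [norm_neg, norm_div, Real.norm_eq_abs, Real.norm_eq_abs, abs_of_nonneg (by positivity : (0:ℝ) ≤ (k:ℝ)^s)]
    gcongr
    exact abs_sin_le_one _

lemma sin_deriv {s : ℕ} (hs : 1 < s) (t : ℝ) :
    HasDerivAt (fun t => ∑' k : ℕ, sin (k * t) / (k:ℝ) ^ (s+1)) (∑' k : ℕ, cos (k * t) / (k:ℝ) ^ s) t := by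
  refine hasDerivAt_tsum (g := fun (k : ℕ) t => sin (k * t) / (k:ℝ) ^ (s+1)) (g' := fun (k : ℕ) t => cos (k * t) / (k:ℝ) ^ s)
    (y₀ := 0) (z_summable hs) ?_ ?_ (by simp) t
  · intro k y
    have := (((hasDerivAt_id y).const_mul (k:ℝ)).sin).div_const ((k:ℝ)^(s+1))
    convert! this using 1
    rcases eq_or_ne k 0 with rfl | hk
    · simp [show s ≠ 0 by omega]
    · have : (k:ℝ) ≠ 0 := by exact_mod_cast hk
      simp only [id]
      field_simp
      ring
  · intro k y
    rw [norm_div, Real.norm_eq_abs, Real.norm_eq_abs, abs_of_nonneg (by positivity : (0:ℝ) ≤ (k:ℝ)^s)]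
    gcongr
    exact abs_cos_le_one _

lemma sin2_cont : Continuous (fun t : ℝ => ∑' k : ℕ, sin (k * t) / (k:ℝ) ^ 2) := by
  refine continuous_tsum (fun k => by fun_prop) (z_summable (by omega : 1 < 2)) ?_
  intro k y
  rw [norm_div, Real.norm_eq_abs, Real.norm_eq_abs, abs_of_nonneg (by positivity : (0:ℝ) ≤ (k:ℝ)^2)]
  gcongr
  exact abs_sin_le_one _

/-- the squared modulus of `1 - r e^{it}` -/
lemma sq_pos {r t : ℝ} (ht : t ∈ Ioo (0:ℝ) 2) : 0 < 1 - 2 * r * cos t + r ^ 2 := by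
  have h1 : 0 < sin t := sin_pos_of_pos_of_lt_pi ht.1 (by linarith [ht.2, pi_gt_three])
  nlinarith [sin_sq_add_cos_sq t, sq_nonneg (r - cos t)]

lemma cos_geom {r t : ℝ} (hr : r ∈ Ioo (0:ℝ) 1) :
    HasSum (fun k : ℕ => r ^ k * cos (k * t) / k) (-(Real.log (1 - 2 * r * cos t + r ^ 2) / 2)) := by
  have hn : ‖(r : ℂ) * Complex.exp (t * Complex.I)‖ < 1 := by
    rw [norm_mul, Complex.norm_exp_ofReal_mul_I, Complex.norm_real, Real.norm_eq_abs, abs_of_pos hr.1]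
    simpa using hr.2
  have h := Complex.hasSum_re (Complex.hasSum_taylorSeries_neg_log hn)
  convert! h using 1
  · ext k
    rw [mul_pow, ← Complex.exp_nat_mul, show (k:ℂ) * (t * Complex.I) = ((k * t : ℝ) : ℂ) * Complex.I by push_cast; ring,
      Complex.div_natCast_re, ← Complex.ofReal_pow, Complex.re_ofReal_mul, Complex.exp_ofReal_mul_I_re]
  · rw [Complex.neg_re, Complex.log_re, Complex.norm_def, Real.log_sqrt (Complex.normSq_nonneg _), Complex.normSq_apply]
    have e : 1 - 2 * r * cos t + r ^ 2 = (1 - r * cos t) * (1 - r * cos t) + r * sin t * (r * sin t) := by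
      linear_combination (-r ^ 2) * sin_sq_add_cos_sq t
    rw [e]
    simp [Complex.exp_ofReal_mul_I_re, Complex.exp_ofReal_mul_I_im]

lemma sinr_deriv {r : ℝ} (hr : r ∈ Ioo (0:ℝ) 1) (t : ℝ) :
    HasDerivAt (fun t => ∑' k : ℕ, r ^ k * sin (k * t) / (k:ℝ) ^ 2)
      (-(Real.log (1 - 2 * r * cos t + r ^ 2) / 2)) t := by
  rw [← (cos_geom hr).tsum_eq]
  refine hasDerivAt_tsum (g := fun (k : ℕ) t => r ^ k * sin (k * t) / (k:ℝ) ^ 2) (g' := fun (k : ℕ) t => r ^ k * cos (k * t) / k)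
    (y₀ := 0) (summable_geometric_of_lt_one hr.1.le hr.2) ?_ ?_ (by simp) t
  · intro k y
    have := ((((hasDerivAt_id y).const_mul (k:ℝ)).sin).const_mul (r^k)).div_const ((k:ℝ)^2)
    convert! this using 1
    rcases eq_or_ne k 0 with rfl | hk
    · simp
    · have : (k:ℝ) ≠ 0 := by exact_mod_cast hk
      simp only [id]
      field_simp
  · intro k y
    rw [norm_div, norm_mul, norm_pow, Real.norm_eq_abs, Real.norm_eq_abs, Real.norm_eq_abs, abs_of_pos hr.1,
      abs_of_nonneg (by positivity : (0:ℝ) ≤ (k:ℝ))]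
    have hp := pow_nonneg hr.1.le k
    rcases Nat.eq_zero_or_pos k with rfl | hk
    · simp
    · have : (1:ℝ) ≤ k := by exact_mod_cast hk
      rw [div_le_iff₀ (by linarith)]
      have := abs_cos_le_one (k * y)
      gcongr
      linarith

lemma sin2_deriv {t : ℝ} (ht : t ∈ Ioo (0:ℝ) 2) :
    HasDerivAt (fun t => ∑' k : ℕ, sin (k * t) / (k:ℝ) ^ 2) (-Real.log (2 * sin (t / 2))) t := by
  have key : HasDerivAt (fun t => ∑' k : ℕ, sin (k * t) / (k:ℝ) ^ 2)
      (-(Real.log (1 - 2 * 1 * cos t + 1 ^ 2) / 2)) t := by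
    refine hasDerivAt_of_tendstoLocallyUniformlyOn (l := 𝓝[<] (1:ℝ)) (s := Ioo (0:ℝ) 2) (g' := fun t => (-(Real.log (1 - 2 * 1 * cos t + 1 ^ 2) / 2)))
      (f := fun r t => ∑' k : ℕ, r ^ k * sin (k * t) / (k:ℝ) ^ 2)
      (f' := fun r t => -(Real.log (1 - 2 * r * cos t + r ^ 2) / 2)) isOpen_Ioo ?_ ?_ ?_ ht
    · rw [tendstoLocallyUniformlyOn_iff_forall_isCompact isOpen_Ioo]
      intro K hK hKc u hu
      obtain ⟨v, hv, h⟩ := hKc.mem_uniformity_of_prod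
        (f := fun r t : ℝ => -(Real.log (1 - 2 * r * cos t + r ^ 2) / 2)) (s := univ) (q := 1)
        (by
          rintro ⟨r, t⟩ ⟨_, h⟩
          apply ContinuousAt.continuousWithinAt
          have := (sq_pos (r := r) (hK h)).ne'
          simp only [Function.uncurry_def]
          have hc : ContinuousAt (fun p : ℝ × ℝ => 1 - 2 * p.1 * cos p.2 + p.1 ^ 2) (r, t) := by fun_prop
          exact ((hc.log this).div_const 2).neg) (mem_univ _) (symm_le_uniformity hu)
      rw [nhdsWithin_univ] at hv
      filter_upwards [mem_nhdsWithin_of_mem_nhds hv] with r hr x hx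
      exact h r hr x hx
    · filter_upwards [Ioo_mem_nhdsLT (show (0:ℝ) < 1 by norm_num)] with r hr x _
      exact sinr_deriv hr x
    · intro x _
      have : ContinuousOn (fun r : ℝ => ∑' k : ℕ, r ^ k * sin (k * x) / (k:ℝ) ^ 2) (Icc 0 1) := by
        refine continuousOn_tsum (fun k => by fun_prop) (z_summable (by omega : 1 < 2)) ?_
        intro k r hr
        rw [norm_div, norm_mul, norm_pow, Real.norm_eq_abs, Real.norm_eq_abs, Real.norm_eq_abs, abs_of_nonneg hr.1,
          abs_of_nonneg (by positivity : (0:ℝ) ≤ (k:ℝ)^2)]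
        gcongr
        exact mul_le_one₀ (pow_le_one₀ hr.1 hr.2) (abs_nonneg _) (abs_sin_le_one _)
      have h := (this 1 (by simp)).tendsto
      simp only [one_pow, one_mul] at h
      refine h.mono_left ?_
      rw [← nhdsWithin_Ioo_eq_nhdsLT (show (0:ℝ) < 1 by norm_num)]
      exact nhdsWithin_mono _ Ioo_subset_Icc_self
  convert! key using 1
  have h1 : 0 < sin (t/2) := sin_pos_of_pos_of_lt_pi (by linarith [ht.1]) (by linarith [ht.2, pi_gt_three])
  have : 1 - 2 * 1 * cos t + 1 ^ 2 = (2 * sin (t/2)) ^ 2 := by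
    have h2 := cos_two_mul (t/2)
    rw [mul_div_cancel₀ t two_ne_zero] at h2
    nlinarith [sin_sq_add_cos_sq (t/2)]
  rw [this, Real.log_pow]
  push_cast; ring

noncomputable def c (n : ℕ) : ℝ := z (2 * (n + 1)) / (n + 1) / (2 * π) ^ (2 * (n + 1))

lemma log_sin {t : ℝ} (ht : t ∈ Ioo (0:ℝ) 2) :
    -Real.log (2 * sin (t / 2)) = -Real.log t + ∑' n, c n * t ^ (2 * (n + 1)) := by
  obtain ⟨x, hx⟩ : ∃ x, x = t / (2 * π) := ⟨_, rfl⟩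
  have hpi := pi_gt_three
  have hx0 : 0 < x := by rw [hx]; have := ht.1; positivity
  have hx1 : x < 1 := by rw [hx, div_lt_one (by positivity)]; linarith [ht.2]
  have htx : t = 2 * π * x := by rw [hx]; field_simp
  have hb : ∀ m : ℕ, 0 ≤ x ^ 2 / ((m:ℝ) + 1) ^ 2 ∧ x ^ 2 / ((m:ℝ) + 1) ^ 2 < 1 := by
    intro m
    refine ⟨by positivity, ?_⟩
    rw [div_lt_one (by positivity)]
    have : (0:ℝ) ≤ m := Nat.cast_nonneg m
    nlinarith
  have hsin : 0 < sin (π * x) := sin_pos_of_pos_of_lt_pi (by positivity) (by nlinarith)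
  have h1 : HasSum (fun m : ℕ => -Real.log (1 - x ^ 2 / ((m:ℝ) + 1) ^ 2)) (-Real.log (sin (π * x) / (π * x))) := by
    rw [hasSum_iff_tendsto_nat_of_nonneg]
    · have h := (Real.tendsto_euler_sin_prod x).div_const (π * x)
      have h' := ((Real.continuousAt_log (by positivity : sin (π * x) / (π * x) ≠ 0)).tendsto.comp h).neg
      refine h'.congr fun n => ?_
      simp only [Function.comp]
      rw [mul_div_cancel_left₀ _ (by positivity), Real.log_prod (fun m _ => by linarith [(hb m).2]), Finset.sum_neg_distrib]
    · intro m
      have := Real.log_nonpos (x := 1 - x ^ 2 / ((m:ℝ) + 1) ^ 2) (by linarith [hb m]) (by linarith [hb m])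
      linarith
  have h2 : ∀ m : ℕ, HasSum (fun n : ℕ => (x ^ 2 / ((m:ℝ) + 1) ^ 2) ^ (n + 1) / ((n:ℝ) + 1)) (-Real.log (1 - x ^ 2 / ((m:ℝ) + 1) ^ 2)) :=
    fun m => hasSum_pow_div_log_of_abs_lt_one (by rw [abs_of_nonneg (hb m).1]; exact (hb m).2)
  have h3 : Summable (fun p : ℕ × ℕ => (x ^ 2 / ((p.1:ℝ) + 1) ^ 2) ^ (p.2 + 1) / ((p.2:ℝ) + 1)) := by
    rw [summable_prod_of_nonneg]
    · refine ⟨fun m => (h2 m).summable, ?_⟩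
      simp only [(h2 _).tsum_eq]
      exact h1.summable
    · intro p; positivity
  have h4 := h3.hasSum.prod_fiberwise h2
  have h5 := ((Equiv.prodComm ℕ ℕ).hasSum_iff.2 h3.hasSum).prod_fiberwise (g := fun n => c n * t ^ (2 * (n + 1))) (by
    intro n
    have h := (z_hasSum (s := 2 * (n+1)) (by omega)).mul_left (x ^ (2 * (n+1)) / (n + 1))
    convert! h using 1
    · ext m
      simp only [Function.comp, Equiv.prodComm_apply, Prod.swap]
      rw [div_pow, ← pow_mul, ← pow_mul]
      field_simp
    · rw [c, htx, mul_pow (2 * π)]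
      field_simp)
  have h6 := h4.unique h1
  rw [h5.tsum_eq, h6, Real.log_div hsin.ne' (by positivity), Real.log_mul two_ne_zero (by rw [htx]; convert! hsin.ne' using 2; ring), htx,
    show 2 * π * x = 2 * (π * x) by ring, Real.log_mul two_ne_zero (by positivity), mul_div_cancel_left₀ _ two_ne_zero]
  ring

noncomputable def p : ℕ → ℕ → ℝ
  | 0, n => c n
  | j + 1, n => p j n / ((2 * (n + 1) + j : ℕ) + 1)

noncomputable def P (j : ℕ) (t : ℝ) : ℝ := ∑' n, p j n * t ^ (2 * (n + 1) + j)

lemma p_nonneg (j n : ℕ) : 0 ≤ p j n := by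
  induction j with
  | zero => have := z_nonneg (2 * (n + 1)); simp only [p, c]; positivity
  | succ j ih => simp only [p]; positivity

lemma p_le (j n : ℕ) : p j n ≤ c n := by
  induction j with
  | zero => exact le_rfl
  | succ j ih =>
    refine le_trans ?_ ih
    simp only [p]
    exact div_le_self (p_nonneg j n) (by linarith [(Nat.cast_nonneg (2 * (n + 1) + j) : (0:ℝ) ≤ _)])

lemma p_summable (j : ℕ) : Summable fun n => |p j n| * 2 ^ (2 * (n + 1) + j) := by
  have hpi := pi_gt_three
  have hg : Summable fun n : ℕ => (z 2 * 2 ^ j * (1 / π ^ 2)) * (1 / π ^ 2) ^ n :=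
    (summable_geometric_of_lt_one (by positivity) (by rw [div_lt_one (by positivity)]; nlinarith)).mul_left _
  refine Summable.of_nonneg_of_le (fun n => by positivity) (fun n => ?_) hg
  rw [abs_of_nonneg (p_nonneg j n)]
  have h1 : c n ≤ z 2 / (2 * π) ^ (2 * (n + 1)) := by
    rw [c]
    gcongr
    refine (div_le_self (z_nonneg _) (by linarith [(Nat.cast_nonneg n : (0:ℝ) ≤ _)])).trans (z_le (by omega))
  calc p j n * 2 ^ (2 * (n + 1) + j) ≤ (z 2 / (2 * π) ^ (2 * (n + 1))) * 2 ^ (2 * (n + 1) + j) := by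
        gcongr; exact (p_le j n).trans h1
    _ = _ := by
        rw [mul_pow, pow_add, pow_mul π, div_pow, one_pow, pow_succ (π ^ 2)]
        field_simp

lemma P_deriv (j : ℕ) {t : ℝ} (ht : t ∈ Ioo (-2:ℝ) 2) : HasDerivAt (P (j + 1)) (P j t) t :=
  pow_deriv (d := p j) (e := fun n => 2 * (n + 1) + j) (p_summable j) ht

lemma P_cont (j : ℕ) : ContinuousOn (P (j + 1)) (Ico 0 2) := fun t ht =>
  (P_deriv j ⟨by linarith [ht.1], ht.2⟩).continuousAt.continuousWithinAt

lemma P_zero (j : ℕ) : P j 0 = 0 := by simp [P]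

lemma S2_eq : ∀ t ∈ Ico (0:ℝ) 2, ∑' k : ℕ, sin (k * t) / (k:ℝ) ^ 2 = -(t * Real.log t - t) + P 1 t := by
  refine eq_aux (f' := fun t => -Real.log t + P 0 t) sin2_cont.continuousOn ?_ ?_ ?_ (by simp [P_zero])
  · exact ((continuous_mul_log.sub continuous_id).neg.continuousOn).add (P_cont 0)
  · intro t ht
    have := sin2_deriv ht
    rwa [log_sin ht] at this
  · intro t ht
    have h := (((hasDerivAt_mul_log ht.1.ne').sub (hasDerivAt_id t)).neg).add (P_deriv 0 ⟨by linarith [ht.1], ht.2⟩)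
    convert! h using 1
    ring

lemma cont_log (k : ℕ) : Continuous fun t : ℝ => t ^ (k + 1) * Real.log t := by
  have : (fun t : ℝ => t ^ (k + 1) * Real.log t) = fun t => t ^ k * (t * Real.log t) := by ext; ring
  rw [this]
  exact (continuous_pow k).mul continuous_mul_log

lemma deriv_log (k : ℕ) {t : ℝ} (ht : 0 < t) :
    HasDerivAt (fun t : ℝ => t ^ (k + 1) * Real.log t) ((k + 1) * t ^ k * Real.log t + t ^ k) t := by
  have h := (hasDerivAt_pow (k + 1) t).mul (Real.hasDerivAt_log ht.ne')
  convert! h using 1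
  rw [pow_succ]
  push_cast
  field_simp

lemma C3_eq : ∀ t ∈ Ico (0:ℝ) 2, ∑' k : ℕ, cos (k * t) / (k:ℝ) ^ 3 =
    z 3 + (1 / 2 * (t ^ 2 * Real.log t) - 3 / 4 * t ^ 2) - P 2 t := by
  refine eq_aux (f' := fun t => -∑' k : ℕ, sin (k * t) / (k:ℝ) ^ 2) ?_ ?_ ?_ ?_ (by simp [P_zero, z])
  · exact fun t _ => (cos_deriv (s := 2) (by omega) t).continuousAt.continuousWithinAt
  · have := cont_log 1
    exact ((by fun_prop : Continuous fun t : ℝ => z 3 + (1 / 2 * (t ^ 2 * Real.log t) - 3 / 4 * t ^ 2)).continuousOn).sub (P_cont 1)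
  · exact fun t _ => cos_deriv (s := 2) (by omega) t
  · intro t ht
    have h := (((deriv_log 1 ht.1).const_mul (1/2)).sub ((hasDerivAt_pow 2 t).const_mul (3/4)) |>.const_add (z 3)).sub (P_deriv 1 ⟨by linarith [ht.1], ht.2⟩)
    rw [S2_eq t ⟨ht.1.le, ht.2⟩]
    convert! h using 1
    push_cast
    ring

lemma S4_eq : ∀ t ∈ Ico (0:ℝ) 2, ∑' k : ℕ, sin (k * t) / (k:ℝ) ^ 4 =
    z 3 * t + (1 / 6 * (t ^ 3 * Real.log t) - 11 / 36 * t ^ 3) - P 3 t := by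
  refine eq_aux (f' := fun t => ∑' k : ℕ, cos (k * t) / (k:ℝ) ^ 3) ?_ ?_ ?_ ?_ (by simp [P_zero])
  · exact fun t _ => (sin_deriv (s := 3) (by omega) t).continuousAt.continuousWithinAt
  · have := cont_log 2
    exact ((by fun_prop : Continuous fun t : ℝ => z 3 * t + (1 / 6 * (t ^ 3 * Real.log t) - 11 / 36 * t ^ 3)).continuousOn).sub (P_cont 2)
  · exact fun t _ => sin_deriv (s := 3) (by omega) t
  · intro t ht
    have h := (((hasDerivAt_id t).const_mul (z 3)).add (((deriv_log 2 ht.1).const_mul (1/6)).sub ((hasDerivAt_pow 3 t).const_mul (11/36)))).sub (P_deriv 2 ⟨by linarith [ht.1], ht.2⟩)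
    rw [C3_eq t ⟨ht.1.le, ht.2⟩]
    convert! h using 1
    push_cast
    ring

lemma C5_eq : ∀ t ∈ Ico (0:ℝ) 2, ∑' k : ℕ, cos (k * t) / (k:ℝ) ^ 5 =
    z 5 - z 3 / 2 * t ^ 2 - (1 / 24 * (t ^ 4 * Real.log t) - 25 / 288 * t ^ 4) + P 4 t := by
  refine eq_aux (f' := fun t => -∑' k : ℕ, sin (k * t) / (k:ℝ) ^ 4) ?_ ?_ ?_ ?_ (by simp [P_zero, z])
  · exact fun t _ => (cos_deriv (s := 4) (by omega) t).continuousAt.continuousWithinAt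
  · have := cont_log 3
    exact ((by fun_prop : Continuous fun t : ℝ => z 5 - z 3 / 2 * t ^ 2 - (1 / 24 * (t ^ 4 * Real.log t) - 25 / 288 * t ^ 4)).continuousOn).add (P_cont 3)
  · exact fun t _ => cos_deriv (s := 4) (by omega) t
  · intro t ht
    have h := ((((hasDerivAt_pow 2 t).const_mul (z 3 / 2)).const_sub (z 5)).sub (((deriv_log 3 ht.1).const_mul (1/24)).sub ((hasDerivAt_pow 4 t).const_mul (25/288)))).add (P_deriv 3 ⟨by linarith [ht.1], ht.2⟩)
    rw [S4_eq t ⟨ht.1.le, ht.2⟩]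
    convert! h using 1
    push_cast
    ring

lemma mult_sum (q : ℕ) (hq : q ≠ 0) :
    HasSum (fun k : ℕ => if q ∣ k then 1 / (k:ℝ) ^ 5 else 0) (z 5 / (q:ℝ) ^ 5) := by
  have hinj : Function.Injective (fun k : ℕ => q * k) := fun a b h => Nat.eq_of_mul_eq_mul_left (Nat.pos_of_ne_zero hq) h
  rw [← hinj.hasSum_iff]
  · have h := ((z_summable (s := 5) (by omega)).hasSum).div_const ((q:ℝ)^5)
    convert! h using 1
    ext k
    have : (q:ℝ) ≠ 0 := by exact_mod_cast hq
    simp only [Function.comp, dvd_mul_right, if_true]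
    push_cast
    rw [mul_pow, div_div, mul_comm]
  · intro k hk
    rw [if_neg]
    rintro ⟨a, rfl⟩
    exact hk ⟨a, rfl⟩

lemma cos_mod (k : ℕ) : cos (k * (π / 3)) = 1 / 2 - (if 2 ∣ k then 1 else 0) - 3 / 2 * (if 3 ∣ k then 1 else 0)
    + 3 * (if 6 ∣ k then (1:ℝ) else 0) := by
  have hk : k = k % 6 + 6 * (k / 6) := (Nat.mod_add_div k 6).symm
  obtain ⟨r, m, hr, rfl⟩ : ∃ r m, r < 6 ∧ k = r + 6 * m := ⟨_, _, Nat.mod_lt _ (by omega), hk⟩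
  have e : ((r + 6 * m : ℕ) : ℝ) * (π / 3) = r * (π / 3) + m * (2 * π) := by push_cast; ring
  rw [e, cos_add_nat_mul_two_pi]
  have d2 : 2 ∣ r + 6 * m ↔ 2 ∣ r := by omega
  have d3 : 3 ∣ r + 6 * m ↔ 3 ∣ r := by omega
  have d6 : 6 ∣ r + 6 * m ↔ 6 ∣ r := by omega
  simp only [d2, d3, d6]
  have c1 := cos_pi_div_three
  have c2 : cos (2 * (π / 3)) = -(1/2) := by rw [cos_two_mul, c1]; norm_num
  interval_cases r
  · norm_num
  · norm_num
  · push_cast; rw [c2]; norm_num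
  · rw [show ((3:ℕ):ℝ) * (π / 3) = π by push_cast; ring, cos_pi]; norm_num
  · rw [show ((4:ℕ):ℝ) * (π / 3) = π / 3 + π by push_cast; ring, cos_add_pi, c1]; norm_num
  · rw [show ((5:ℕ):ℝ) * (π / 3) = 2 * (π / 3) + π by push_cast; ring, cos_add_pi, c2]; norm_num

lemma C5_val : ∑' k : ℕ, cos (k * (π / 3)) / (k:ℝ) ^ 5 = 25 / 54 * z 5 := by
  have h := ((((mult_sum 1 (by omega)).mul_left (1/2)).sub (mult_sum 2 (by omega))).sub
    ((mult_sum 3 (by omega)).mul_left (3/2))).add ((mult_sum 6 (by omega)).mul_left 3)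
  have e : (fun k : ℕ => cos (k * (π / 3)) / (k:ℝ) ^ 5) = fun k : ℕ => 1 / 2 * (if 1 ∣ k then 1 / (k:ℝ) ^ 5 else 0)
    - (if 2 ∣ k then 1 / (k:ℝ) ^ 5 else 0) - 3 / 2 * (if 3 ∣ k then 1 / (k:ℝ) ^ 5 else 0) + 3 * (if 6 ∣ k then 1 / (k:ℝ) ^ 5 else 0) := by
    ext k
    rw [cos_mod]
    simp only [one_dvd, if_true]
    split_ifs <;> ring
  rw [e, h.tsum_eq]
  push_cast
  ring

/-- real version of the term -/
noncomputable def T (n : ℕ) : ℝ :=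
  z (2 * (n + 1)) / (((2 * (n + 1) : ℕ) : ℝ) * ((2 * (n + 1) + 1 : ℕ) : ℝ) *
                ((2 * (n + 1) + 2 : ℕ) : ℝ) * ((2 * (n + 1) + 3 : ℕ) : ℝ) *
                ((2 * (n + 1) + 4 : ℕ) : ℝ)) * (1 / 6) ^ (2 * (n + 1))

lemma P_term (n : ℕ) : p 4 n * (π / 3) ^ (2 * (n + 1) + 4) = 2 * π ^ 4 / 81 * T n := by
  have hp := pi_pos
  have e : (π / 3) ^ (2 * (n + 1) + 4) = (2 * π) ^ (2 * (n + 1)) * (1 / 6) ^ (2 * (n + 1)) * (π ^ 4 / 81) := by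
    rw [← mul_pow, pow_add]
    congr 1
    · congr 1; ring
    · ring
  rw [e]
  simp only [p, T, c]
  push_cast
  field_simp
  ring

lemma T_hasSum : HasSum T (81 / (2 * π ^ 4) * P 4 (π / 3)) := by
  have hp := pi_pos
  have h3 := pi_lt_four
  have hs : Summable fun n => p 4 n * (π / 3) ^ (2 * (n + 1) + 4) := by
    refine Summable.of_nonneg_of_le (fun n => mul_nonneg (p_nonneg 4 n) (by positivity)) (fun n => ?_) (p_summable 4)
    have := p_nonneg 4 n
    rw [abs_of_nonneg this]
    gcongr
    linarith
  have h := hs.hasSum.mul_left (81 / (2 * π ^ 4))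
  refine h.congr_fun ?_ 
  intro n
  rw [P_term]
  field_simp

end ZF

theorem zeta_five_series :
    ∃ S : ℂ,
      HasSum
        (fun n : ℕ =>
          riemannZeta ((2 * (n + 1) : ℕ) : ℂ) /
              (((2 * (n + 1) : ℕ) : ℂ) * ((2 * (n + 1) + 1 : ℕ) : ℂ) *
                ((2 * (n + 1) + 2 : ℕ) : ℂ) * ((2 * (n + 1) + 3 : ℕ) : ℂ) *
                ((2 * (n + 1) + 4 : ℕ) : ℂ)) *
            (1 / 6 : ℂ) ^ (2 * (n + 1))) S ∧
      riemannZeta 5 =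
        3 * (Real.pi : ℂ) ^ 2 / 29 * riemannZeta 3 - 25 * (Real.pi : ℂ) ^ 4 / 12528 +
          (Real.pi : ℂ) ^ 4 / 1044 * (Real.log (Real.pi / 3) : ℂ) -
          4 * (Real.pi : ℂ) ^ 4 / 87 * S := by
  refine ⟨((81 / (2 * π ^ 4) * ZF.P 4 (π / 3) : ℝ) : ℂ), ?_, ?_⟩
  · have h := Complex.hasSum_ofReal.2 ZF.T_hasSum
    convert! h using 1
    ext n
    rw [ZF.zeta_eq (by omega)]
    simp only [ZF.T]
    push_cast
    rfl
  · have h5 := ZF.zeta_eq (s := 5) (by omega)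
    have h3 := ZF.zeta_eq (s := 3) (by omega)
    push_cast at h5 h3
    rw [h5, h3]
    have h := ZF.C5_eq (π / 3) ⟨by positivity, by linarith [pi_lt_four]⟩
    rw [ZF.C5_val] at h
    have hp : π ≠ 0 := pi_ne_zero
    have key : ZF.z 5 = 3 * π ^ 2 / 29 * ZF.z 3 - 25 * π ^ 4 / 12528 + π ^ 4 / 1044 * Real.log (π / 3)
        - 4 * π ^ 4 / 87 * (81 / (2 * π ^ 4) * ZF.P 4 (π / 3)) := by
      have e : 4 * π ^ 4 / 87 * (81 / (2 * π ^ 4) * ZF.P 4 (π / 3)) = 54 / 29 * ZF.P 4 (π / 3) := by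
        field_simp; ring
      rw [e]
      linear_combination (-54 / 29) * h
    exact_mod_cast key
end
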